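/- Let f : 𝔻 → ℝ be a minimal graph over the open unit disk. Then at the origin the scale-invariant curvature quantity satisfies W(0,0)² · |K(0,0)| < (2π²/27)(2 + √31), i.e. |f_uu(0,0) f_vv(0,0) − f_uv(0,0)²| / (1 + f_u(0,0)² + f_v(0,0)²) < (2π²/27)(2 + √31) ≈ 5.53265. -/

import Mathlib

open Real

/-- The open unit disk in `ℝ × ℝ`. -/
def unitDisk : Set (ℝ × ℝ) := {p : ℝ × ℝ | p.1 ^ 2 + p.2 ^ 2 < 1}

/-- Partial derivative with respect to the first coordinate `u`. -/
noncomputable def pu (f : ℝ × ℝ → ℝ) (p : ℝ × ℝ) : ℝ :=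
  deriv (fun u : ℝ => f (u, p.2)) p.1

/-- Partial derivative with respect to the second coordinate `v`. -/
noncomputable def pv (f : ℝ × ℝ → ℝ) (p : ℝ × ℝ) : ℝ :=
  deriv (fun v : ℝ => f (p.1, v)) p.2

/-- `f : 𝔻 → ℝ` is a minimal graph over the open unit disk: it is `C²` there and
    satisfies the minimal surface equation. -/
def IsMinimalGraph (f : ℝ × ℝ → ℝ) : Prop :=
  ContDiffOn ℝ 2 f unitDisk ∧
    ∀ p ∈ unitDisk,
      (1 + (pv f p) ^ 2) * pu (pu f) p
        - 2 * pu f p * pv f p * pv (pu f) p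
        + (1 + (pu f p) ^ 2) * pv (pv f) p = 0

section
open Set Filter Topology MeasureTheory ComplexConjugate

/-- A continuous function on an open set vanishing off a compact subset extends by zero. -/
lemma continuous_indicator_of_compact {Ω K : Set ℂ} (hΩ : IsOpen Ω) (hK : IsCompact K)
    {X : ℂ → ℝ} (hX : ContinuousOn X Ω) (h0 : ∀ z ∈ Ω \ K, X z = 0) (hKΩ : K ⊆ Ω) :
    Continuous (Ω.indicator X) := by
  rw [continuous_iff_continuousAt]
  intro z
  by_cases hz : z ∈ Ω
  · refine (hX.continuousAt (hΩ.mem_nhds hz)).congr ?_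
    filter_upwards [hΩ.mem_nhds hz] with w hw
    rw [indicator_of_mem hw]
  · have hz' : z ∈ Kᶜ := fun h => hz (hKΩ h)
    refine (continuousAt_const (y := (0 : ℝ))).congr ?_
    filter_upwards [hK.isClosed.isOpen_compl.mem_nhds hz'] with w hw
    by_cases hwΩ : w ∈ Ω
    · rw [indicator_of_mem hwΩ, h0 w ⟨hwΩ, hw⟩]
    · rw [indicator_of_notMem hwΩ]

lemma indicator_eq_zero_of_compact {Ω K : Set ℂ} {X : ℂ → ℝ} (h0 : ∀ z ∈ Ω \ K, X z = 0) :
    ∀ z ∉ K, Ω.indicator X z = 0 := by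
  intro z hz
  by_cases hwΩ : z ∈ Ω
  · rw [indicator_of_mem hwΩ, h0 z ⟨hwΩ, hz⟩]
  · rw [indicator_of_notMem hwΩ]

lemma integrableOn_of_compact {Ω K : Set ℂ} (hΩ : IsOpen Ω) (hK : IsCompact K)
    {X : ℂ → ℝ} (hX : ContinuousOn X Ω) (h0 : ∀ z ∈ Ω \ K, X z = 0) (hKΩ : K ⊆ Ω) :
    IntegrableOn X Ω := by
  rw [← integrable_indicator_iff hΩ.measurableSet]
  exact (continuous_indicator_of_compact hΩ hK hX h0 hKΩ).integrable_of_hasCompactSupport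
    (HasCompactSupport.intro hK (indicator_eq_zero_of_compact h0))

/-- The integral of a directional derivative of a compactly supported function vanishes. -/
lemma integral_lineDeriv_eq_zero {Ω K : Set ℂ} (hΩ : IsOpen Ω) (hK : IsCompact K)
    (hKΩ : K ⊆ Ω) {X X' : ℂ → ℝ} {v : ℂ} (hX : ContinuousOn X Ω) (hX' : ContinuousOn X' Ω)
    (h0 : ∀ z ∈ Ω \ K, X z = 0) (h0' : ∀ z ∈ Ω \ K, X' z = 0)
    (hd : ∀ z ∈ Ω, HasDerivAt (fun t : ℝ => X (z + t • v)) (X' z) 0) :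
    ∫ z in Ω, X' z = 0 := by
  rw [← integral_indicator hΩ.measurableSet]
  have c := continuous_indicator_of_compact hΩ hK hX h0 hKΩ
  have c' := continuous_indicator_of_compact hΩ hK hX' h0' hKΩ
  have s : HasCompactSupport (Ω.indicator X) :=
    HasCompactSupport.intro hK (indicator_eq_zero_of_compact h0)
  have s' : HasCompactSupport (Ω.indicator X') :=
    HasCompactSupport.intro hK (indicator_eq_zero_of_compact h0')
  have hline : ∀ z, HasLineDerivAt ℝ (Ω.indicator X) (Ω.indicator X' z) z v := by
    intro z
    have hcont : ContinuousAt (fun t : ℝ => z + t • v) 0 := by fun_prop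
    by_cases hz : z ∈ Ω
    · rw [indicator_of_mem hz]
      refine (hd z hz).congr_of_eventuallyEq ?_
      have : ∀ᶠ t in 𝓝 (0 : ℝ), z + t • v ∈ Ω :=
        hcont.eventually_mem (by simpa using hΩ.mem_nhds hz)
      filter_upwards [this] with t ht
      rw [indicator_of_mem ht]
    · rw [indicator_of_notMem hz]
      have hz' : z ∈ Kᶜ := fun h => hz (hKΩ h)
      refine (hasDerivAt_const (0 : ℝ) (0 : ℝ)).congr_of_eventuallyEq ?_
      have : ∀ᶠ t in 𝓝 (0 : ℝ), z + t • v ∈ Kᶜ :=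
        hcont.eventually_mem (by simpa using hK.isClosed.isOpen_compl.mem_nhds hz')
      filter_upwards [this] with t ht
      exact indicator_eq_zero_of_compact h0 _ ht
  have := integral_bilinear_hasLineDerivAt_right_eq_neg_left_of_integrable (μ := volume)
    (f := fun _ : ℂ => (1 : ℝ)) (f' := fun _ => 0) (g := Ω.indicator X) (g' := Ω.indicator X')
    (v := v) (B := ContinuousLinearMap.mul ℝ ℝ) (by simp)
    (by simpa using c'.integrable_of_hasCompactSupport s')
    (by simpa using c.integrable_of_hasCompactSupport s)
    (fun z _ => hasDerivAt_const _ _) (fun z _ => hline z)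
  simpa using this

/-- A `C¹` bump profile supported where `x ≤ ε`. -/
noncomputable def bump (ε x : ℝ) : ℝ := (max 0 (ε - x)) ^ 2

lemma bump_eq_zero {ε x : ℝ} (h : ε ≤ x) : bump ε x = 0 := by
  rw [bump, max_eq_left (by linarith)]; norm_num

lemma bump_nonneg (ε x : ℝ) : 0 ≤ bump ε x := sq_nonneg _

lemma hasDerivAt_max_zero_pow (n : ℕ) (x : ℝ) :
    HasDerivAt (fun y : ℝ => (max 0 y) ^ (n + 2)) ((n + 2) * (max 0 x) ^ (n + 1)) x := by
  rcases lt_trichotomy x 0 with h | h | h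
  · have h1 : HasDerivAt (fun _ : ℝ => (0 : ℝ)) 0 x := hasDerivAt_const _ _
    rw [max_eq_left h.le]
    simp only [ne_eq, Nat.add_eq_zero_iff, one_ne_zero, and_false, not_false_eq_true, zero_pow,
      mul_zero]
    refine h1.congr_of_eventuallyEq ?_
    filter_upwards [Iio_mem_nhds h] with y hy
    rw [max_eq_left (le_of_lt hy)]; simp
  · subst h
    rw [hasDerivAt_iff_isLittleO_nhds_zero]
    have : (fun h : ℝ => max 0 (0 + h) ^ (n + 2) - max (0 : ℝ) 0 ^ (n + 2)
        - h • (((n : ℝ) + 2) * max (0 : ℝ) 0 ^ (n + 1))) = fun h => (max 0 h) ^ (n + 2) := by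
      ext h; simp
    rw [this]
    have h2 : (fun h : ℝ => (max 0 h) ^ (n + 2)) =O[𝓝 0] fun h : ℝ => h ^ (n + 2) := by
      refine Asymptotics.IsBigO.of_bound 1 (Eventually.of_forall fun h => ?_)
      rw [one_mul, norm_pow, norm_pow]
      gcongr
      rcases le_total 0 h with hh | hh
      · rw [max_eq_right hh]
      · rw [max_eq_left hh]; simp
    refine h2.trans_isLittleO ?_
    simpa using (Asymptotics.isLittleO_pow_pow (𝕜 := ℝ) (m := 1) (n := n + 2) (by omega))
  · have h1 : HasDerivAt (fun y : ℝ => y ^ (n + 2)) (((n + 2 : ℕ) : ℝ) * x ^ (n + 2 - 1)) x :=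
      hasDerivAt_pow _ _
    rw [max_eq_right h.le]
    have h2 := h1.congr_of_eventuallyEq (f₁ := fun y : ℝ => (max 0 y) ^ (n + 2)) (by
      filter_upwards [Ioi_mem_nhds h] with y hy
      rw [max_eq_right (le_of_lt hy)])
    exact h2.congr_deriv (by push_cast; simp)

lemma hasDerivAt_bump (ε x : ℝ) : HasDerivAt (bump ε) (-2 * max 0 (ε - x)) x := by
  have h := hasDerivAt_max_zero_pow 0 (ε - x)
  have h2 := h.comp x ((hasDerivAt_const x ε).sub (hasDerivAt_id x))
  exact h2.congr_deriv (by simp)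

lemma continuous_bump (ε : ℝ) : Continuous (bump ε) := by
  unfold bump; fun_prop

/-- Rate of change of `bump ε |A + conj B|² (|A'|² - |B'|²)` when `A`, `B` move with
velocities `E`, `G`. -/
noncomputable def bumpJacRate (ε : ℝ) (A B E G : ℂ → ℂ) (z : ℂ) : ℝ :=
  -2 * max 0 (ε - Complex.normSq (A z + conj (B z)))
      * (2 * (((A z).re + (B z).re) * ((E z).re + (G z).re)
        + ((A z).im - (B z).im) * ((E z).im - (G z).im)))
      * (Complex.normSq (deriv A z) - Complex.normSq (deriv B z))
    + bump ε (Complex.normSq (A z + conj (B z)))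
      * (2 * ((deriv A z).re * (deriv E z).re + (deriv A z).im * (deriv E z).im)
        - 2 * ((deriv B z).re * (deriv G z).re + (deriv B z).im * (deriv G z).im))

lemma hasDerivAt_line {Ω : Set ℂ} (hΩ : IsOpen Ω) {A : ℂ → ℂ} (hA : DifferentiableOn ℂ A Ω)
    {z : ℂ} (hz : z ∈ Ω) (v : ℂ) :
    HasDerivAt (fun t : ℝ => A (z + t • v)) (deriv A z * v) 0 := by
  have h1 : HasDerivAt A (deriv A z) (z + (0 : ℝ) • v) := by
    simpa using (hA.differentiableAt (hΩ.mem_nhds hz)).hasDerivAt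
  have h2 : HasDerivAt (fun t : ℝ => z + t • v) v 0 := by
    have : HasDerivAt (fun t : ℝ => t • v) ((1 : ℝ) • v) 0 := (hasDerivAt_id (0 : ℝ)).smul_const v
    simpa using this.const_add z
  exact h1.comp (0 : ℝ) h2

lemma HasDerivAt.complex_re {F : ℝ → ℂ} {d : ℂ} {t : ℝ} (h : HasDerivAt F d t) :
    HasDerivAt (fun s => (F s).re) d.re t :=
  Complex.reCLM.hasFDerivAt.comp_hasDerivAt t h

lemma HasDerivAt.complex_im {F : ℝ → ℂ} {d : ℂ} {t : ℝ} (h : HasDerivAt F d t) :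
    HasDerivAt (fun s => (F s).im) d.im t :=
  Complex.imCLM.hasFDerivAt.comp_hasDerivAt t h

lemma normSq_add_conj (a b : ℂ) :
    Complex.normSq (a + conj b) = (a.re + b.re) ^ 2 + (a.im - b.im) ^ 2 := by
  rw [Complex.normSq_apply]; simp; ring

theorem integral_bumpJacRate {Ω K : Set ℂ} (hΩ : IsOpen Ω) (hK : IsCompact K) (hKΩ : K ⊆ Ω)
    {A B E G : ℂ → ℂ} (hA : DifferentiableOn ℂ A Ω) (hB : DifferentiableOn ℂ B Ω)
    (hE : DifferentiableOn ℂ E Ω) (hG : DifferentiableOn ℂ G Ω) {ε : ℝ}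
    (hD : ∀ z ∈ Ω \ K, ε ≤ Complex.normSq (A z + conj (B z))) :
    ∫ z in Ω, bumpJacRate ε A B E G z = 0 := by
  have cA := hA.continuousOn
  have cB := hB.continuousOn
  have cE := hE.continuousOn
  have cG := hG.continuousOn
  have hA' := hA.deriv hΩ
  have hB' := hB.deriv hΩ
  have hE' := hE.deriv hΩ
  have hG' := hG.deriv hΩ
  have cA' := hA'.continuousOn
  have cB' := hB'.continuousOn
  have cE' := hE'.continuousOn
  have cG' := hG'.continuousOn
  have cA'' := (hA'.deriv hΩ).continuousOn
  have cB'' := (hB'.deriv hΩ).continuousOn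
  have cbump := continuous_bump ε
  have bump_cont : ContinuousOn (fun z => bump ε (Complex.normSq (A z + conj (B z)))) Ω :=
    cbump.comp_continuousOn (Complex.continuous_normSq.comp_continuousOn
      (cA.add (Complex.continuous_conj.comp_continuousOn cB)))
  have n_cont : ContinuousOn (fun z => Complex.normSq (A z + conj (B z))) Ω :=
    (Complex.continuous_normSq.comp_continuousOn
      (cA.add (Complex.continuous_conj.comp_continuousOn cB)))
  have re_c : ∀ {F : ℂ → ℂ}, ContinuousOn F Ω → ContinuousOn (fun z => (F z).re) Ω :=
    fun h => Complex.continuous_re.comp_continuousOn h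
  have im_c : ∀ {F : ℂ → ℂ}, ContinuousOn F Ω → ContinuousOn (fun z => (F z).im) Ω :=
    fun h => Complex.continuous_im.comp_continuousOn h
  have r1 := re_c cA
  have r2 := re_c cB
  have r3 := re_c cE
  have r4 := re_c cG
  have r5 := re_c cA'
  have r6 := re_c cB'
  have r7 := re_c cE'
  have r8 := re_c cG'
  have r9 := re_c cA''
  have r10 := re_c cB''
  have i1 := im_c cA
  have i2 := im_c cB
  have i3 := im_c cE
  have i4 := im_c cG
  have i5 := im_c cA'
  have i6 := im_c cB'
  have i7 := im_c cE'
  have i8 := im_c cG'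
  have i9 := im_c cA''
  have i10 := im_c cB''
  have hz0 : ∀ z ∈ Ω \ K, max 0 (ε - Complex.normSq (A z + conj (B z))) = 0 := fun z hz =>
    max_eq_left (by linarith [hD z hz])
  have hb0 : ∀ z ∈ Ω \ K, bump ε (Complex.normSq (A z + conj (B z))) = 0 := fun z hz =>
    bump_eq_zero (hD z hz)
  have X_der : ∀ (z : ℂ), z ∈ Ω → ∀ v : ℂ, HasDerivAt
      (fun t : ℝ => bump ε (Complex.normSq (A (z + t • v) + conj (B (z + t • v)))))
      (-2 * max 0 (ε - Complex.normSq (A z + conj (B z)))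
        * (2 * ((A z).re + (B z).re) * ((deriv A z * v).re + (deriv B z * v).re)
          + 2 * ((A z).im - (B z).im) * ((deriv A z * v).im - (deriv B z * v).im))) 0 := by
    intro z hz v
    have a := hasDerivAt_line hΩ hA hz v
    have b := hasDerivAt_line hΩ hB hz v
    have h1 := ((a.complex_re.add b.complex_re).pow 2).add ((a.complex_im.sub b.complex_im).pow 2)
    have h2 := (hasDerivAt_bump ε (Complex.normSq (A z + conj (B z))))
    have e : Complex.normSq (A z + conj (B z)) =
      ((fun s : ℝ => ((A (z + s • v)).re + (B (z + s • v)).re) ^ 2 +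
        ((A (z + s • v)).im - (B (z + s • v)).im) ^ 2) (0 : ℝ)) := by
      rw [normSq_add_conj]; simp
    rw [e] at h2
    have h3 := h2.comp (0 : ℝ) h1
    have e3 : (fun t : ℝ => bump ε (Complex.normSq (A (z + t • v) + conj (B (z + t • v))))) =
        bump ε ∘ (fun s : ℝ => ((A (z + s • v)).re + (B (z + s • v)).re) ^ 2 +
        ((A (z + s • v)).im - (B (z + s • v)).im) ^ 2) := by
      ext t
      simp [normSq_add_conj]
    rw [e3]
    refine h3.congr_deriv ?_
    rw [← e]
    simp
  set X1 : ℂ → ℝ := fun z => bump ε (Complex.normSq (A z + conj (B z)))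
    * (((E z).re + (G z).re) * ((deriv A z).re - (deriv B z).re)
      + ((E z).im - (G z).im) * ((deriv A z).im + (deriv B z).im)) with hX1
  set X2 : ℂ → ℝ := fun z => bump ε (Complex.normSq (A z + conj (B z)))
    * (((E z).im - (G z).im) * ((deriv A z).re + (deriv B z).re)
      - ((E z).re + (G z).re) * ((deriv A z).im - (deriv B z).im)) with hX2
  set Y1 : ℂ → ℝ := fun z => -2 * max 0 (ε - Complex.normSq (A z + conj (B z)))
        * (2 * ((A z).re + (B z).re) * ((deriv A z).re + (deriv B z).re)
          + 2 * ((A z).im - (B z).im) * ((deriv A z).im - (deriv B z).im))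
    * (((E z).re + (G z).re) * ((deriv A z).re - (deriv B z).re)
      + ((E z).im - (G z).im) * ((deriv A z).im + (deriv B z).im))
    + bump ε (Complex.normSq (A z + conj (B z)))
    * (((deriv E z).re + (deriv G z).re) * ((deriv A z).re - (deriv B z).re)
      + ((E z).re + (G z).re) * ((deriv (deriv A) z).re - (deriv (deriv B) z).re)
      + (((deriv E z).im - (deriv G z).im) * ((deriv A z).im + (deriv B z).im)
      + ((E z).im - (G z).im) * ((deriv (deriv A) z).im + (deriv (deriv B) z).im))) with hY1
  set Y2 : ℂ → ℝ := fun z => -2 * max 0 (ε - Complex.normSq (A z + conj (B z)))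
        * (2 * ((A z).re + (B z).re) * (-(deriv A z).im - (deriv B z).im)
          + 2 * ((A z).im - (B z).im) * ((deriv A z).re - (deriv B z).re))
    * (((E z).im - (G z).im) * ((deriv A z).re + (deriv B z).re)
      - ((E z).re + (G z).re) * ((deriv A z).im - (deriv B z).im))
    + bump ε (Complex.normSq (A z + conj (B z)))
    * (((deriv E z).re - (deriv G z).re) * ((deriv A z).re + (deriv B z).re)
      + ((E z).im - (G z).im) * (-(deriv (deriv A) z).im - (deriv (deriv B) z).im)
      - ((-(deriv E z).im - (deriv G z).im) * ((deriv A z).im - (deriv B z).im)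
      + ((E z).re + (G z).re) * ((deriv (deriv A) z).re - (deriv (deriv B) z).re))) with hY2
  have c1 : ContinuousOn X1 Ω := by rw [hX1]; fun_prop
  have c2 : ContinuousOn X2 Ω := by rw [hX2]; fun_prop
  have c3 : ContinuousOn Y1 Ω := by rw [hY1]; fun_prop
  have c4 : ContinuousOn Y2 Ω := by rw [hY2]; fun_prop
  have z1 : ∀ z ∈ Ω \ K, X1 z = 0 := fun z hz => by simp only [hX1]; rw [hb0 z hz]; ring
  have z2 : ∀ z ∈ Ω \ K, X2 z = 0 := fun z hz => by simp only [hX2]; rw [hb0 z hz]; ring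
  have z3 : ∀ z ∈ Ω \ K, Y1 z = 0 := fun z hz => by
    simp only [hY1]; rw [hb0 z hz, hz0 z hz]; ring
  have z4 : ∀ z ∈ Ω \ K, Y2 z = 0 := fun z hz => by
    simp only [hY2]; rw [hb0 z hz, hz0 z hz]; ring
  have I1 : ∫ z in Ω, Y1 z = 0 := by
    refine integral_lineDeriv_eq_zero (v := 1) hΩ hK hKΩ c1 c3 z1 z3 fun z hz => ?_
    have e := hasDerivAt_line hΩ hE hz 1
    have g := hasDerivAt_line hΩ hG hz 1
    have a' := hasDerivAt_line hΩ hA' hz 1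
    have b' := hasDerivAt_line hΩ hB' hz 1
    have h := (X_der z hz 1).mul (((e.complex_re.add g.complex_re).mul
      (a'.complex_re.sub b'.complex_re)).add ((e.complex_im.sub g.complex_im).mul
      (a'.complex_im.add b'.complex_im)))
    exact h.congr_deriv (by simp [hY1])
  have I2 : ∫ z in Ω, Y2 z = 0 := by
    refine integral_lineDeriv_eq_zero (v := Complex.I) hΩ hK hKΩ c2 c4 z2 z4 fun z hz => ?_
    have e := hasDerivAt_line hΩ hE hz Complex.I
    have g := hasDerivAt_line hΩ hG hz Complex.I
    have a' := hasDerivAt_line hΩ hA' hz Complex.I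
    have b' := hasDerivAt_line hΩ hB' hz Complex.I
    have h := (X_der z hz Complex.I).mul (((e.complex_im.sub g.complex_im).mul
      (a'.complex_re.add b'.complex_re)).sub ((e.complex_re.add g.complex_re).mul
      (a'.complex_im.sub b'.complex_im)))
    exact h.congr_deriv (by simp [hY2]; ring)
  have hsum : ∀ z, bumpJacRate ε A B E G z = Y1 z + Y2 z := by
    intro z
    simp only [bumpJacRate, hY1, hY2, Complex.normSq_apply (deriv A z),
      Complex.normSq_apply (deriv B z)]
    ring
  simp_rw [hsum]
  rw [integral_add (integrableOn_of_compact hΩ hK c3 z3 hKΩ)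
    (integrableOn_of_compact hΩ hK c4 z4 hKΩ), I1, I2, add_zero]

/-- The pull-back density of `bump ε |w|² dw` under the harmonic map `A + conj B`. -/
noncomputable def bumpJac (ε : ℝ) (A B : ℂ → ℂ) (z : ℂ) : ℝ :=
  bump ε (Complex.normSq (A z + conj (B z)))
    * (Complex.normSq (deriv A z) - Complex.normSq (deriv B z))

lemma continuousOn_bumpJac {Ω : Set ℂ} (hΩ : IsOpen Ω) (ε : ℝ)
    {A B : ℂ → ℂ} (hA : DifferentiableOn ℂ A Ω) (hB : DifferentiableOn ℂ B Ω) :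
    ContinuousOn (bumpJac ε A B) Ω := by
  have cA := hA.continuousOn
  have cB := hB.continuousOn
  have cA' := (hA.deriv hΩ).continuousOn
  have cB' := (hB.deriv hΩ).continuousOn
  have n_cont : ContinuousOn (fun z => Complex.normSq (A z + conj (B z))) Ω :=
    (Complex.continuous_normSq.comp_continuousOn
      (cA.add (Complex.continuous_conj.comp_continuousOn cB)))
  exact ((continuous_bump ε).comp_continuousOn n_cont).mul
    ((Complex.continuous_normSq.comp_continuousOn cA').sub
      (Complex.continuous_normSq.comp_continuousOn cB'))

/-- Homotopy invariance of the integral of `bumpJac`. -/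
theorem integral_bumpJac_homotopy {Ω K : Set ℂ} (hΩ : IsOpen Ω) (hK : IsCompact K) (hKΩ : K ⊆ Ω)
    {A B E G : ℂ → ℂ} (hA : DifferentiableOn ℂ A Ω) (hB : DifferentiableOn ℂ B Ω)
    (hE : DifferentiableOn ℂ E Ω) (hG : DifferentiableOn ℂ G Ω) {ε : ℝ}
    (hD : ∀ t ∈ Icc (0 : ℝ) 1, ∀ z ∈ Ω \ K,
      ε ≤ Complex.normSq ((A z + t * E z) + conj (B z + t * G z))) :
    ∫ z in Ω, bumpJac ε (fun z => A z + E z) (fun z => B z + G z) z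
      = ∫ z in Ω, bumpJac ε A B z := by
  have dA : ∀ z ∈ Ω, DifferentiableAt ℂ A z := fun z hz => hA.differentiableAt (hΩ.mem_nhds hz)
  have dB : ∀ z ∈ Ω, DifferentiableAt ℂ B z := fun z hz => hB.differentiableAt (hΩ.mem_nhds hz)
  have dE : ∀ z ∈ Ω, DifferentiableAt ℂ E z := fun z hz => hE.differentiableAt (hΩ.mem_nhds hz)
  have dG : ∀ z ∈ Ω, DifferentiableAt ℂ G z := fun z hz => hG.differentiableAt (hΩ.mem_nhds hz)
  have hder : ∀ {F H : ℂ → ℂ} {z : ℂ} (t : ℝ), DifferentiableAt ℂ F z → DifferentiableAt ℂ H z →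
      deriv (fun z => F z + t * H z) z = deriv F z + t * deriv H z := by
    intro F H z t hF hH
    exact (hF.hasDerivAt.add (hH.hasDerivAt.const_mul (t : ℂ))).deriv
  set R : ℝ → ℂ → ℝ := fun t z =>
    -2 * max 0 (ε - Complex.normSq ((A z + t * E z) + conj (B z + t * G z)))
      * (2 * (((A z + t * E z).re + (B z + t * G z).re) * ((E z).re + (G z).re)
        + ((A z + t * E z).im - (B z + t * G z).im) * ((E z).im - (G z).im)))
      * (Complex.normSq (deriv A z + t * deriv E z) - Complex.normSq (deriv B z + t * deriv G z))
    + bump ε (Complex.normSq ((A z + t * E z) + conj (B z + t * G z)))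
      * (2 * ((deriv A z + t * deriv E z).re * (deriv E z).re
            + (deriv A z + t * deriv E z).im * (deriv E z).im)
        - 2 * ((deriv B z + t * deriv G z).re * (deriv G z).re
            + (deriv B z + t * deriv G z).im * (deriv G z).im)) with hR
  have hRate : ∀ (t : ℝ), ∀ z ∈ Ω, R t z = bumpJacRate ε (fun z => A z + t * E z)
      (fun z => B z + t * G z) E G z := by
    intro t z hz
    simp only [hR, bumpJacRate, hder t (dA z hz) (dE z hz), hder t (dB z hz) (dG z hz)]
  have hR0 : ∀ t ∈ Icc (0 : ℝ) 1, ∀ z ∈ Ω \ K, R t z = 0 := by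
    intro t ht z hz
    have h := hD t ht z hz
    simp only [hR]
    rw [bump_eq_zero h, max_eq_left (by linarith)]
    ring
  have hRint : ∀ t ∈ Icc (0 : ℝ) 1, ∫ z in K, R t z = 0 := by
    intro t ht
    have h1 : ∫ z in Ω, R t z = 0 := by
      rw [setIntegral_congr_fun hΩ.measurableSet (hRate t)]
      exact integral_bumpJacRate hΩ hK hKΩ (hA.add (hE.const_mul _)) (hB.add (hG.const_mul _))
        hE hG (hD t ht)
    rw [← h1]
    exact (setIntegral_eq_of_subset_of_forall_sdiff_eq_zero hΩ.measurableSet hKΩ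
      fun z hz => hR0 t ht z hz).symm
  set J : ℝ → ℂ → ℝ := fun t z =>
    bump ε (Complex.normSq ((A z + t * E z) + conj (B z + t * G z)))
      * (Complex.normSq (deriv A z + t * deriv E z)
        - Complex.normSq (deriv B z + t * deriv G z)) with hJ
  have hJR : ∀ z t, HasDerivAt (fun t => J t z) (R t z) t := by
    intro z t
    have line : ∀ a e : ℂ, HasDerivAt (fun t : ℝ => a + t * e) e t := by
      intro a e
      have : HasDerivAt (fun t : ℝ => (t : ℂ)) 1 t := Complex.ofRealCLM.hasDerivAt
      simpa using (this.mul_const e).const_add a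
    have nsq : ∀ a e : ℂ, HasDerivAt (fun t : ℝ => Complex.normSq (a + t * e))
        (2 * ((a + t * e).re * e.re + (a + t * e).im * e.im)) t := by
      intro a e
      have h := (((line a e).complex_re).mul ((line a e).complex_re)).add
        (((line a e).complex_im).mul ((line a e).complex_im))
      have e2 : (fun t : ℝ => Complex.normSq (a + t * e)) = fun t : ℝ =>
        (a + t * e).re * (a + t * e).re + (a + t * e).im * (a + t * e).im := by
        ext t; rw [Complex.normSq_apply]
      rw [e2]
      exact h.congr_deriv (by ring)
    have e3 : ∀ t : ℝ, (A z + t * E z) + conj (B z + t * G z)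
        = (A z + conj (B z)) + t * (E z + conj (G z)) := by
      intro t; simp; ring
    have h1 := nsq (A z + conj (B z)) (E z + conj (G z))
    have h2 := (hasDerivAt_bump ε _).comp t h1
    have h3 := h2.mul ((nsq (deriv A z) (deriv E z)).sub (nsq (deriv B z) (deriv G z)))
    simp only [hJ, e3]
    refine h3.congr_deriv ?_
    simp only [hR, e3, Pi.sub_apply, Function.comp_apply, Complex.add_re, Complex.add_im,
      Complex.conj_re, Complex.conj_im, Complex.mul_re, Complex.mul_im, Complex.ofReal_re,
      Complex.ofReal_im]
    ring
  have hcont : ContinuousOn (Function.uncurry R) (univ ×ˢ Ω) := by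
    have pull : ∀ {F : ℂ → ℂ}, ContinuousOn F Ω →
        ContinuousOn (fun p : ℝ × ℂ => F p.2) (univ ×ˢ Ω) := fun h =>
      h.comp continuousOn_snd fun p hp => hp.2
    have cA := pull hA.continuousOn
    have cB := pull hB.continuousOn
    have cE := pull hE.continuousOn
    have cG := pull hG.continuousOn
    have cA' := pull (hA.deriv hΩ).continuousOn
    have cB' := pull (hB.deriv hΩ).continuousOn
    have cE' := pull (hE.deriv hΩ).continuousOn
    have cG' := pull (hG.deriv hΩ).continuousOn
    have re_c : ∀ {F : ℝ × ℂ → ℂ}, ContinuousOn F (univ ×ˢ Ω) →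
        ContinuousOn (fun z => (F z).re) (univ ×ˢ Ω) :=
      fun h => Complex.continuous_re.comp_continuousOn h
    have im_c : ∀ {F : ℝ × ℂ → ℂ}, ContinuousOn F (univ ×ˢ Ω) →
        ContinuousOn (fun z => (F z).im) (univ ×ˢ Ω) :=
      fun h => Complex.continuous_im.comp_continuousOn h
    have ns_c : ∀ {F : ℝ × ℂ → ℂ}, ContinuousOn F (univ ×ˢ Ω) →
        ContinuousOn (fun z => Complex.normSq (F z)) (univ ×ˢ Ω) :=
      fun h => Complex.continuous_normSq.comp_continuousOn h
    have ct : ContinuousOn (fun p : ℝ × ℂ => (p.1 : ℂ)) (univ ×ˢ Ω) :=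
      (Complex.continuous_ofReal.comp continuous_fst).continuousOn
    have a := cA.add (ct.mul cE)
    have b := cB.add (ct.mul cG)
    have a' := cA'.add (ct.mul cE')
    have b' := cB'.add (ct.mul cG')
    have n := ns_c (a.add (Complex.continuous_conj.comp_continuousOn b))
    have bu := (continuous_bump ε).comp_continuousOn n
    have mx := ((continuous_const (y := (0 : ℝ))).max
      ((continuous_const (y := ε)).sub continuous_id)).comp_continuousOn n
    exact (((continuousOn_const (c := (-2 : ℝ))).mul mx).mul ((continuousOn_const (c := (2 : ℝ))).mul
      ((((re_c a).add (re_c b)).mul ((re_c cE).add (re_c cG))).add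
      (((im_c a).sub (im_c b)).mul ((im_c cE).sub (im_c cG))))) |>.mul ((ns_c a').sub (ns_c b'))).add
      (bu.mul (((continuousOn_const (c := (2 : ℝ))).mul (((re_c a').mul (re_c cE')).add
        ((im_c a').mul (im_c cE')))).sub ((continuousOn_const (c := (2 : ℝ))).mul
        (((re_c b').mul (re_c cG')).add ((im_c b').mul (im_c cG'))))))
  have hFTC : ∀ z ∈ K, ∫ t in (0 : ℝ)..1, R t z = J 1 z - J 0 z := by
    intro z hz
    refine intervalIntegral.integral_eq_sub_of_hasDerivAt (fun t _ => hJR z t) ?_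
    refine Continuous.intervalIntegrable ?_ _ _
    rw [← continuousOn_univ]
    exact hcont.comp (f := fun t : ℝ => (t, z)) (by fun_prop) fun t _ => ⟨mem_univ _, hKΩ hz⟩
  have hJ0 : ∀ t ∈ Icc (0 : ℝ) 1, ∀ z ∈ Ω \ K, J t z = 0 := by
    intro t ht z hz
    simp only [hJ]
    rw [bump_eq_zero (hD t ht z hz), zero_mul]
  have hJc : ∀ t : ℝ, ∀ z ∈ Ω, J t z = bumpJac ε (fun z => A z + t * E z)
      (fun z => B z + t * G z) z := by
    intro t z hz
    simp only [hJ, bumpJac, hder t (dA z hz) (dE z hz), hder t (dB z hz) (dG z hz)]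
  have hJcont : ∀ t : ℝ, ContinuousOn (J t) Ω := by
    intro t
    refine ContinuousOn.congr ?_ (hJc t)
    exact continuousOn_bumpJac hΩ ε (hA.add (hE.const_mul _)) (hB.add (hG.const_mul _))
  have hswap : ∫ z in K, (∫ t in (0 : ℝ)..1, R t z) = 0 := by
    simp_rw [intervalIntegral.integral_of_le (zero_le_one' ℝ), ← integral_Icc_eq_integral_Ioc]
    rw [← integral_integral_swap]
    · rw [setIntegral_congr_fun measurableSet_Icc hRint]
      simp
    · rw [Measure.prod_restrict]
      exact (hcont.mono (prod_mono (subset_univ _) hKΩ)).integrableOn_compact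
        (isCompact_Icc.prod hK)
  rw [setIntegral_congr_fun hK.measurableSet hFTC] at hswap
  rw [integral_sub ((hJcont 1).mono hKΩ |>.integrableOn_compact hK)
    ((hJcont 0).mono hKΩ |>.integrableOn_compact hK), sub_eq_zero] at hswap
  have hfull : ∀ t ∈ Icc (0 : ℝ) 1, ∫ z in Ω, bumpJac ε (fun z => A z + t * E z)
      (fun z => B z + t * G z) z = ∫ z in K, J t z := by
    intro t ht
    rw [← setIntegral_congr_fun hΩ.measurableSet (hJc t)]
    exact setIntegral_eq_of_subset_of_forall_sdiff_eq_zero hΩ.measurableSet hKΩ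
      fun z hz => hJ0 t ht z hz
  have h1 := hfull 1 (by simp)
  have h0 := hfull 0 (by simp)
  simp only [Complex.ofReal_one, one_mul, Complex.ofReal_zero, zero_mul, add_zero] at h1 h0
  rw [h1, hswap, ← h0]

lemma integral_radial_bump {n : ℕ} (hn : 1 ≤ n) {c ε : ℝ} (hc : 0 < c) (hε : 0 < ε) :
    ∫ y in Ioi (0 : ℝ), y * (bump ε (c * y ^ (2 * n)) * (n ^ 2 * c * y ^ (2 * (n - 1))))
      = n * ε ^ 3 / 6 := by
  have hder : ∀ y : ℝ, HasDerivAt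
      (fun y : ℝ => -(n / 6 : ℝ) * (max 0 (ε - c * y ^ (2 * n))) ^ 3)
      (y * (bump ε (c * y ^ (2 * n)) * (n ^ 2 * c * y ^ (2 * (n - 1))))) y := by
    intro y
    have h1 : HasDerivAt (fun y : ℝ => ε - c * y ^ (2 * n))
        (-(c * (((2 * n : ℕ) : ℝ) * y ^ (2 * n - 1)))) y := by
      have := ((hasDerivAt_pow (2 * n) y).const_mul c).const_sub ε
      exact this
    have h2 := ((hasDerivAt_max_zero_pow 1 (ε - c * y ^ (2 * n))).comp y h1).const_mul
      (-(n / 6 : ℝ))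
    refine h2.congr_deriv ?_
    obtain ⟨k, rfl⟩ : ∃ k, n = k + 1 := ⟨n - 1, by omega⟩
    have e1 : 2 * (k + 1) - 1 = 2 * k + 1 := by omega
    simp only [bump, e1, Nat.add_sub_cancel]
    push_cast
    ring
  rw [integral_Ioi_of_hasDerivAt_of_nonneg (l := 0) (hder 0).continuousAt.continuousWithinAt
    (fun y _ => hder y)]
  · rw [zero_pow (by omega), mul_zero, sub_zero, max_eq_right hε.le]
    ring
  · intro y hy
    have : (0 : ℝ) < y := hy
    have := bump_nonneg ε (c * y ^ (2 * n))
    positivity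
  · refine tendsto_const_nhds.congr' ?_
    have h1 : Tendsto (fun y : ℝ => c * y ^ (2 * n)) atTop atTop :=
      (tendsto_pow_atTop (by omega)).const_mul_atTop hc
    filter_upwards [h1.eventually_ge_atTop ε] with y hy
    rw [max_eq_left (by linarith)]
    simp

/-- The monomial `α (z - z₀) ^ n` covers a neighbourhood of the origin `n` times. -/
theorem integral_bumpJac_monomial {n : ℕ} (hn : 1 ≤ n) {α z₀ : ℂ} (hα : α ≠ 0) {r ε : ℝ}
    (hr : 0 < r) (hε : 0 < ε) (hle : ε ≤ Complex.normSq α * r ^ (2 * n)) :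
    ∫ z in Metric.ball z₀ r, bumpJac ε (fun z => α * (z - z₀) ^ n) (fun _ => 0) z
      = n * π * ε ^ 3 / 3 := by
  have hc : 0 < Complex.normSq α := Complex.normSq_pos.2 hα
  have hval : ∀ z, bumpJac ε (fun z => α * (z - z₀) ^ n) (fun _ => 0) z =
      (fun y : ℝ => bump ε (Complex.normSq α * y ^ (2 * n))
        * (n ^ 2 * Complex.normSq α * y ^ (2 * (n - 1)))) ‖z - z₀‖ := by
    intro z
    have hd : deriv (fun z => α * (z - z₀) ^ n) z = α * (n * (z - z₀) ^ (n - 1)) := by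
      have := ((((hasDerivAt_id z).sub_const z₀).pow n).const_mul α).deriv
      simp only [id_eq, mul_one] at this
      exact this
    simp only [bumpJac, hd, map_zero, add_zero, deriv_const', sub_zero, map_mul, map_pow,
      Complex.normSq_eq_norm_sq, Complex.norm_natCast]
    ring_nf
  rw [setIntegral_eq_integral_of_forall_compl_eq_zero]
  · simp_rw [hval]
    rw [integral_sub_right_eq_self (fun z : ℂ => (fun y : ℝ => bump ε (Complex.normSq α * y ^ (2 * n))
        * (n ^ 2 * Complex.normSq α * y ^ (2 * (n - 1)))) ‖z‖) z₀,
      integral_fun_norm_addHaar volume (fun y : ℝ => bump ε (Complex.normSq α * y ^ (2 * n))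
        * (n ^ 2 * Complex.normSq α * y ^ (2 * (n - 1))))]
    simp only [Complex.finrank_real_complex, Nat.add_one_sub_one, pow_one, smul_eq_mul]
    rw [integral_radial_bump hn hc hε, Measure.real, Complex.volume_ball]
    simp
    ring
  · intro z hz
    rw [hval]
    have : r ≤ ‖z - z₀‖ := by
      simpa [dist_eq_norm] using hz
    have : r ^ (2 * n) ≤ ‖z - z₀‖ ^ (2 * n) := by gcongr
    simp only
    rw [bump_eq_zero (hle.trans (by gcongr)), zero_mul]

/-- Integration of a power bound on the derivative along rays. -/
lemma norm_sub_le_of_deriv_le_pow {z₀ : ℂ} {r C : ℝ} {m : ℕ} {f : ℂ → ℂ}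
    (hf : DifferentiableOn ℂ f (Metric.ball z₀ r))
    (hb : ∀ z ∈ Metric.ball z₀ r, ‖deriv f z‖ ≤ C * ‖z - z₀‖ ^ m) :
    ∀ z ∈ Metric.ball z₀ r, ‖f z - f z₀‖ ≤ C * ‖z - z₀‖ ^ (m + 1) := by
  intro z hz
  have hr : 0 < r := Metric.pos_of_mem_ball hz
  have hsub : Metric.closedBall z₀ ‖z - z₀‖ ⊆ Metric.ball z₀ r := by
    apply Metric.closedBall_subset_ball
    simpa [dist_eq_norm] using hz
  by_cases hC : 0 ≤ C
  swap
  · have hz0 : z = z₀ := by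
      by_contra h
      have h1 := hb z hz
      have h2 : 0 < ‖z - z₀‖ ^ m := by
        have : 0 < ‖z - z₀‖ := norm_pos_iff.2 (sub_ne_zero.2 h)
        positivity
      have := norm_nonneg (deriv f z)
      nlinarith
    simp [hz0]
  have := (convex_closedBall z₀ ‖z - z₀‖).norm_image_sub_le_of_norm_deriv_le (f := f) (𝕜 := ℂ)
    (C := C * ‖z - z₀‖ ^ m)
    (fun w hw => hf.differentiableAt (Metric.isOpen_ball.mem_nhds (hsub hw)))
    (fun w hw => (hb w (hsub hw)).trans (by
      have : ‖w - z₀‖ ≤ ‖z - z₀‖ := by simpa [dist_eq_norm] using hw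
      gcongr)) (x := z₀) (y := z) (by simp) (by simp [dist_eq_norm])
  calc _ ≤ _ := this
    _ = _ := by ring

/-- Near a zero of order `m + 1`, a sense-preserving harmonic map covers the origin
`m + 1` times. -/
theorem exists_integral_bumpJac_eq_of_zero {A B q a : ℂ → ℂ} {z₀ : ℂ} {Ω : Set ℂ} {m : ℕ}
    (hΩ : IsOpen Ω) (hz₀ : z₀ ∈ Ω) (hA : DifferentiableOn ℂ A Ω) (hB : DifferentiableOn ℂ B Ω)
    (hq : ContinuousAt q z₀) (hq1 : ‖q z₀‖ < 1)
    (hBA : ∀ z ∈ Ω, deriv B z = q z ^ 2 * deriv A z) (h0 : A z₀ + conj (B z₀) = 0)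
    (ha : ContinuousAt a z₀) (ha0 : a z₀ ≠ 0)
    (hAm : ∀ᶠ z in 𝓝 z₀, deriv A z = (z - z₀) ^ m * a z) :
    ∃ r > 0, Metric.ball z₀ r ⊆ Ω ∧ ∃ ε₀ > 0, ∀ ε : ℝ, 0 < ε → ε ≤ ε₀ →
      ∫ z in Metric.ball z₀ r, bumpJac ε A B z = (m + 1) * π * ε ^ 3 / 3 := by
  set α : ℂ := a z₀ / (m + 1 : ℕ) with hα
  have hm : ((m + 1 : ℕ) : ℂ) ≠ 0 := Nat.cast_ne_zero.2 (by omega)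
  have hα0 : α ≠ 0 := div_ne_zero ha0 hm
  have hαa : a z₀ = α * (m + 1 : ℕ) := by rw [hα]; field_simp
  set c : ℝ := ‖α‖ * (1 - ‖q z₀‖ ^ 2) with hc
  have hαp : 0 < ‖α‖ := norm_pos_iff.2 hα0
  have hcp : 0 < c := by
    have : ‖q z₀‖ ^ 2 < 1 := by
      have := norm_nonneg (q z₀)
      nlinarith
    exact mul_pos hαp (by linarith)
  have h1 : ∀ᶠ z in 𝓝 z₀, ‖a z - a z₀‖ ≤ c / 4 := by
    have := (Metric.tendsto_nhds.1 ha) (c / 4) (by positivity)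
    filter_upwards [this] with z hz
    rw [← dist_eq_norm]
    exact hz.le
  have h2 : ∀ᶠ z in 𝓝 z₀, ‖q z ^ 2 * a z - q z₀ ^ 2 * a z₀‖ ≤ c / 4 := by
    have := (Metric.tendsto_nhds.1 ((hq.pow 2).mul ha)) (c / 4) (by positivity)
    filter_upwards [this] with z hz
    rw [← dist_eq_norm]
    exact hz.le
  obtain ⟨r, hr, hball⟩ := Metric.eventually_nhds_iff_ball.1
    (h1.and (h2.and (hAm.and (hΩ.mem_nhds hz₀))))
  have hsub : Metric.ball z₀ r ⊆ Ω := fun z hz => (hball z hz).2.2.2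
  have hmono : ∀ β z : ℂ, HasDerivAt (fun z => β * (z - z₀) ^ (m + 1))
      (β * ((m + 1 : ℕ) * (z - z₀) ^ m)) z := by
    intro β z
    have := (((hasDerivAt_id z).sub_const z₀).pow (m + 1)).const_mul β
    simp only [id_eq, mul_one] at this
    exact this
  have dA : ∀ z ∈ Metric.ball z₀ r, HasDerivAt A (deriv A z) z := fun z hz =>
    (hA.differentiableAt (hΩ.mem_nhds (hsub hz))).hasDerivAt
  have dB : ∀ z ∈ Metric.ball z₀ r, HasDerivAt B (deriv B z) z := fun z hz =>
    (hB.differentiableAt (hΩ.mem_nhds (hsub hz))).hasDerivAt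
  have rem : ∀ {H : ℂ → ℂ} (β : ℂ), (∀ z ∈ Metric.ball z₀ r, HasDerivAt H (deriv H z) z) →
      (∀ z ∈ Metric.ball z₀ r, ‖deriv H z - β * ((m + 1 : ℕ) * (z - z₀) ^ m)‖
        ≤ c / 4 * ‖z - z₀‖ ^ m) →
      ∀ z ∈ Metric.ball z₀ r, ‖H z - β * (z - z₀) ^ (m + 1) - H z₀‖
        ≤ c / 4 * ‖z - z₀‖ ^ (m + 1) := by
    intro H β hH hb z hz
    have := norm_sub_le_of_deriv_le_pow (f := fun z => H z - β * (z - z₀) ^ (m + 1))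
      (fun w hw => ((hH w hw).sub (hmono β w)).differentiableAt.differentiableWithinAt)
      (fun w hw => by
        have e := ((hH w hw).sub (hmono β w)).deriv
        have e' : deriv (fun z => H z - β * (z - z₀) ^ (m + 1)) w = _ := e
        rw [e']
        exact hb w hw) z hz
    simpa using this
  have remA := rem α dA (fun z hz => by
    obtain ⟨b1, -, b3, -⟩ := hball z hz
    have : deriv A z - α * ((m + 1 : ℕ) * (z - z₀) ^ m) = (a z - a z₀) * (z - z₀) ^ m := by
      rw [b3, hαa]; ring
    rw [this, norm_mul, norm_pow]
    gcongr)
  have remB := rem (q z₀ ^ 2 * α) dB (fun z hz => by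
    obtain ⟨-, b2, b3, b4⟩ := hball z hz
    have : deriv B z - q z₀ ^ 2 * α * ((m + 1 : ℕ) * (z - z₀) ^ m)
        = (q z ^ 2 * a z - q z₀ ^ 2 * a z₀) * (z - z₀) ^ m := by
      rw [hBA z b4, b3, hαa]; ring
    rw [this, norm_mul, norm_pow]
    gcongr)
  have hlow : ∀ t ∈ Icc (0 : ℝ) 1, ∀ z ∈ Metric.ball z₀ r,
      c / 2 * ‖z - z₀‖ ^ (m + 1) ≤ ‖(α * (z - z₀) ^ (m + 1) + t * (A z - α * (z - z₀) ^ (m + 1)))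
        + conj (0 + t * B z)‖ := by
    intro t ht z hz
    set p := (z - z₀) ^ (m + 1) with hp
    have e : (α * p + t * (A z - α * p)) + conj (0 + t * B z)
        = α * p + (t * (A z - α * p - A z₀) + t * conj (B z - q z₀ ^ 2 * α * p - B z₀)
          + t * conj (q z₀ ^ 2 * α * p)) := by
      simp only [map_add, map_sub, map_mul, map_pow, map_zero, Complex.conj_ofReal]
      linear_combination t * h0
    have nA := remA z hz
    have nB := remB z hz
    have np : ‖p‖ = ‖z - z₀‖ ^ (m + 1) := by rw [hp, norm_pow]
    rw [← np] at nA nB ⊢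
    have ht' : ‖(t : ℂ)‖ ≤ 1 := by
      rw [Complex.norm_real, Real.norm_of_nonneg ht.1]; exact ht.2
    have n1 : ‖(t : ℂ) * (A z - α * p - A z₀)‖ ≤ c / 4 * ‖p‖ := by
      rw [norm_mul]
      exact (mul_le_of_le_one_left (norm_nonneg _) ht').trans nA
    have n2 : ‖(t : ℂ) * conj (B z - q z₀ ^ 2 * α * p - B z₀)‖ ≤ c / 4 * ‖p‖ := by
      rw [norm_mul, RCLike.norm_conj]
      exact (mul_le_of_le_one_left (norm_nonneg _) ht').trans nB
    have n3 : ‖(t : ℂ) * conj (q z₀ ^ 2 * α * p)‖ ≤ ‖q z₀‖ ^ 2 * ‖α‖ * ‖p‖ := by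
      rw [norm_mul, RCLike.norm_conj, norm_mul (_ * _), norm_mul, norm_pow]
      exact mul_le_of_le_one_left (by positivity) ht'
    have n4 : ‖α * p‖ = ‖α‖ * ‖p‖ := norm_mul _ _
    rw [e]
    have t1 := norm_sub_le (α * p + (t * (A z - α * p - A z₀)
      + t * conj (B z - q z₀ ^ 2 * α * p - B z₀) + t * conj (q z₀ ^ 2 * α * p)))
      (t * (A z - α * p - A z₀)
      + t * conj (B z - q z₀ ^ 2 * α * p - B z₀) + t * conj (q z₀ ^ 2 * α * p))
    rw [add_sub_cancel_right] at t1
    have t2 := norm_add₃_le (a := t * (A z - α * p - A z₀))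
      (b := t * conj (B z - q z₀ ^ 2 * α * p - B z₀)) (c := t * conj (q z₀ ^ 2 * α * p))
    have : c / 2 * ‖p‖ = ‖α‖ * ‖p‖ - ‖q z₀‖ ^ 2 * ‖α‖ * ‖p‖ - c / 4 * ‖p‖ - c / 4 * ‖p‖ := by
      rw [hc]; ring
    linarith
  refine ⟨r, hr, hsub, min ((c / 2 * (r / 2) ^ (m + 1)) ^ 2)
    (Complex.normSq α * r ^ (2 * (m + 1))), ?_, ?_⟩
  · have := Complex.normSq_pos.2 hα0
    positivity
  intro ε hε hle
  have hh := integral_bumpJac_homotopy (Ω := Metric.ball z₀ r) (K := Metric.closedBall z₀ (r / 2))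
    (A := fun z => α * (z - z₀) ^ (m + 1)) (B := fun _ => 0)
    (E := fun z => A z - α * (z - z₀) ^ (m + 1)) (G := B) (ε := ε)
    Metric.isOpen_ball (isCompact_closedBall _ _) (Metric.closedBall_subset_ball (by linarith))
    (fun z _ => (hmono α z).differentiableAt.differentiableWithinAt)
    (differentiableOn_const 0)
    (fun z hz => ((dA z hz).sub (hmono α z)).differentiableAt.differentiableWithinAt)
    (hB.mono hsub)
    (fun t ht z hz => by
      rw [Complex.normSq_eq_norm_sq]
      refine (hle.trans (min_le_left _ _)).trans ?_
      have hz2 : r / 2 ≤ ‖z - z₀‖ := by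
        have := hz.2
        rw [Metric.mem_closedBall, dist_eq_norm] at this
        linarith
      have := hlow t ht z hz.1
      have h3 : c / 2 * (r / 2) ^ (m + 1) ≤ c / 2 * ‖z - z₀‖ ^ (m + 1) := by gcongr
      exact pow_le_pow_left₀ (by positivity) (h3.trans this) 2)
  rw [integral_bumpJac_monomial (by omega) hα0 hr hε (hle.trans (min_le_right _ _))] at hh
  simp only [add_sub_cancel, zero_add] at hh
  push_cast at hh
  exact hh

/-- The real differential of the harmonic map `h + conj g`. -/
noncomputable def harmonicDifferential (a b : ℂ) : ℂ →L[ℝ] ℂ :=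
  ContinuousLinearMap.mul ℝ ℂ a
    + Complex.conjCLE.toContinuousLinearMap.comp (ContinuousLinearMap.mul ℝ ℂ b)

lemma det_harmonicDifferential (a b : ℂ) :
    (harmonicDifferential a b).det = Complex.normSq a - Complex.normSq b := by
  rw [ContinuousLinearMap.det, ← LinearMap.det_toMatrix Complex.basisOneI, Matrix.det_fin_two]
  simp [LinearMap.toMatrix_apply, harmonicDifferential, Complex.coe_basisOneI_repr,
    Complex.normSq_apply]
  ring

lemma hasFDerivAt_add_conj {h g : ℂ → ℂ} {z : ℂ} (hh : DifferentiableAt ℂ h z)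
    (hg : DifferentiableAt ℂ g z) :
    HasFDerivAt (fun z => h z + conj (g z))
      (harmonicDifferential (deriv h z) (deriv g z)) z := by
  have h1 : HasFDerivAt h _ z := hh.hasDerivAt.hasFDerivAt.restrictScalars ℝ
  have h2 : HasFDerivAt g _ z := hg.hasDerivAt.hasFDerivAt.restrictScalars ℝ
  have h3 := h1.add ((Complex.conjCLE.toContinuousLinearMap.hasFDerivAt).comp z h2)
  refine h3.congr_fderiv ?_
  ext w
  simp [harmonicDifferential]
  ring

/-- An injective sense-preserving harmonic map onto the disk has degree one. -/
lemma integral_bumpJac_of_injOn {Ω : Set ℂ} (hΩ : IsOpen Ω) {h g : ℂ → ℂ}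
    (hh : DifferentiableOn ℂ h Ω) (hg : DifferentiableOn ℂ g Ω)
    (hpos : ∀ z ∈ Ω, Complex.normSq (deriv g z) ≤ Complex.normSq (deriv h z))
    (hinj : InjOn (fun z => h z + conj (g z)) Ω)
    (himg : (fun z => h z + conj (g z)) '' Ω = Metric.ball 0 1) {ε : ℝ} (hε : 0 < ε)
    (hε1 : ε ≤ 1) : ∫ z in Ω, bumpJac ε h g z = π * ε ^ 3 / 3 := by
  have key := integral_image_eq_integral_abs_det_fderiv_smul (volume : Measure ℂ)
    hΩ.measurableSet (f := fun z => h z + conj (g z))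
    (f' := fun z => harmonicDifferential (deriv h z) (deriv g z))
    (fun z hz => (hasFDerivAt_add_conj (hh.differentiableAt (hΩ.mem_nhds hz))
      (hg.differentiableAt (hΩ.mem_nhds hz))).hasFDerivWithinAt) hinj
    (fun w => bump ε (Complex.normSq w))
  rw [himg] at key
  have mono := integral_bumpJac_monomial (n := 1) le_rfl (α := 1) (z₀ := 0) one_ne_zero
    one_pos hε (by simpa using hε1)
  have e1 : ∀ w : ℂ, bumpJac ε (fun z => 1 * (z - 0) ^ 1) (fun _ => 0) w
      = bump ε (Complex.normSq w) := by
    intro w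
    simp [bumpJac]
  simp_rw [e1] at mono
  rw [mono] at key
  rw [setIntegral_congr_fun hΩ.measurableSet (g := fun z =>
    |(harmonicDifferential (deriv h z) (deriv g z)).det| •
      bump ε (Complex.normSq (h z + conj (g z)))), ← key]
  · push_cast; ring
  · intro z hz
    simp only [bumpJac, det_harmonicDifferential, smul_eq_mul]
    rw [abs_of_nonneg (sub_nonneg.2 (hpos z hz)), mul_comm]

/-- A univalent harmonic map onto the disk and a strictly smaller harmonic map with the same
second dilatation cannot agree to first order at a point. -/
theorem harmonic_comparison {Ω : Set ℂ} (hΩ : IsOpen Ω) (hc : IsPreconnected Ω)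
    {h g H G q : ℂ → ℂ} (hh : DifferentiableOn ℂ h Ω) (hg : DifferentiableOn ℂ g Ω)
    (hH : DifferentiableOn ℂ H Ω) (hG : DifferentiableOn ℂ G Ω) (hq : ContinuousOn q Ω)
    (hq1 : ∀ z ∈ Ω, ‖q z‖ < 1) (hgh : ∀ z ∈ Ω, deriv g z = q z ^ 2 * deriv h z)
    (hGH : ∀ z ∈ Ω, deriv G z = q z ^ 2 * deriv H z)
    (hinj : InjOn (fun z => h z + conj (g z)) Ω)
    (himg : (fun z => h z + conj (g z)) '' Ω = Metric.ball 0 1)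
    (hcpt : ∀ r < 1, IsCompact {z ∈ Ω | ‖h z + conj (g z)‖ ≤ r}) {l : ℝ} (hl : l < 1)
    (hsmall : ∀ z ∈ Ω, ‖H z + conj (G z)‖ ≤ l) {z₀ : ℂ} (hz₀ : z₀ ∈ Ω)
    (h0 : h z₀ + conj (g z₀) = H z₀ + conj (G z₀)) (hd : deriv h z₀ = deriv H z₀) : False := by
  have dh : ∀ z ∈ Ω, DifferentiableAt ℂ h z := fun z hz => hh.differentiableAt (hΩ.mem_nhds hz)
  have dg : ∀ z ∈ Ω, DifferentiableAt ℂ g z := fun z hz => hg.differentiableAt (hΩ.mem_nhds hz)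
  have dH : ∀ z ∈ Ω, DifferentiableAt ℂ H z := fun z hz => hH.differentiableAt (hΩ.mem_nhds hz)
  have dG : ∀ z ∈ Ω, DifferentiableAt ℂ G z := fun z hz => hG.differentiableAt (hΩ.mem_nhds hz)
  have hle : ∀ {a b : ℂ} {z : ℂ}, z ∈ Ω → b = q z ^ 2 * a →
      Complex.normSq b ≤ Complex.normSq a := by
    intro a b z hz e
    rw [e, map_mul, map_pow, Complex.normSq_eq_norm_sq (q z)]
    have h1 : (‖q z‖ ^ 2) ^ 2 ≤ 1 :=
      pow_le_one₀ (by positivity) (pow_le_one₀ (norm_nonneg _) (hq1 z hz).le)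
    exact mul_le_of_le_one_left (Complex.normSq_nonneg _) h1
  set A : ℂ → ℂ := fun z => h z + -H z with hA
  set B : ℂ → ℂ := fun z => g z + -G z with hB
  have dA : DifferentiableOn ℂ A Ω := hh.add hH.neg
  have dB : DifferentiableOn ℂ B Ω := hg.add hG.neg
  have derA : ∀ z ∈ Ω, deriv A z = deriv h z - deriv H z := fun z hz => by
    rw [sub_eq_add_neg]
    exact ((dh z hz).hasDerivAt.add (dH z hz).hasDerivAt.neg).deriv
  have derB : ∀ z ∈ Ω, deriv B z = q z ^ 2 * deriv A z := fun z hz => by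
    have : deriv B z = deriv g z - deriv G z := by
      rw [sub_eq_add_neg]
      exact ((dg z hz).hasDerivAt.add (dG z hz).hasDerivAt.neg).deriv
    rw [this, derA z hz, hgh z hz, hGH z hz]; ring
  have hl0 : 0 ≤ l := (norm_nonneg _).trans (hsmall z₀ hz₀)
  set K := {z ∈ Ω | ‖h z + conj (g z)‖ ≤ (1 + l) / 2} with hK
  have global : ∀ ε : ℝ, 0 < ε → ε ≤ ((1 - l) / 2) ^ 2 →
      (∀ z ∈ Ω \ K, bumpJac ε A B z = 0) ∧ ∫ z in Ω, bumpJac ε A B z = π * ε ^ 3 / 3 := by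
    intro ε hε hε1
    have hD : ∀ t ∈ Icc (0 : ℝ) 1, ∀ z ∈ Ω \ K,
      ε ≤ Complex.normSq ((h z + t * -H z) + conj (g z + t * -G z)) := by
      intro t ht z hz
      have h1 : (1 + l) / 2 < ‖h z + conj (g z)‖ := by
        by_contra hcon
        exact hz.2 ⟨hz.1, not_lt.1 hcon⟩
      have e : (h z + t * -H z) + conj (g z + t * -G z)
          = (h z + conj (g z)) - t * (H z + conj (G z)) := by
        simp only [map_add, map_mul, map_neg, Complex.conj_ofReal]; ring
      rw [e, Complex.normSq_eq_norm_sq]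
      have h2 : ‖(t : ℂ) * (H z + conj (G z))‖ ≤ l := by
        rw [norm_mul, Complex.norm_real, Real.norm_of_nonneg ht.1]
        exact (mul_le_of_le_one_left (norm_nonneg _) ht.2).trans (hsmall z hz.1)
      have h3 := norm_sub_norm_le (h z + conj (g z)) (t * (H z + conj (G z)))
      exact hε1.trans (pow_le_pow_left₀ (by linarith) (by linarith) 2)
    have hint := integral_bumpJac_homotopy hΩ (hcpt _ (by linarith)) (fun z hz => hz.1)
      hh hg hH.neg hG.neg hD
    have hε2 : ε ≤ 1 := hε1.trans (by nlinarith)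
    rw [integral_bumpJac_of_injOn hΩ hh hg (fun z hz => hle hz (hgh z hz)) hinj himg hε hε2] at hint
    refine ⟨fun z hz => ?_, hint⟩
    have := hD 1 (by simp) z hz
    simp only [Complex.ofReal_one, one_mul] at this
    simp only [bumpJac, hA, hB]
    rw [bump_eq_zero this, zero_mul]
  have nonneg : ∀ ε : ℝ, ∀ z ∈ Ω, 0 ≤ bumpJac ε A B z := fun ε z hz =>
    mul_nonneg (bump_nonneg _ _) (sub_nonneg.2 (hle hz (derB z hz)))
  have anA : AnalyticOnNhd ℂ (deriv A) Ω := (dA.deriv hΩ).analyticOnNhd hΩ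
  have hl2 : 0 < ((1 - l) / 2) ^ 2 := pow_pos (by linarith) 2
  by_cases hz : ∀ᶠ z in 𝓝 z₀, deriv A z = 0
  · have hzero := anA.eqOn_zero_of_preconnected_of_eventuallyEq_zero hc hz₀ hz
    have hg1 := (global _ hl2 le_rfl).2
    rw [setIntegral_eq_zero_of_forall_eq_zero] at hg1
    · have := Real.pi_pos
      have : 0 < π * (((1 - l) / 2) ^ 2) ^ 3 / 3 := by positivity
      linarith
    · intro z hzΩ
      have : deriv A z = 0 := hzero hzΩ
      simp [bumpJac, derB z hzΩ, this]
  · obtain ⟨m, a, han, ha0, hev⟩ := ((anA z₀ hz₀).exists_eventuallyEq_pow_smul_nonzero_iff).2 hz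
    have hm : 1 ≤ m := by
      by_contra hm
      have hm0 : m = 0 := by omega
      have := hev.self_of_nhds
      rw [hm0, pow_zero, one_smul, derA z₀ hz₀, hd, sub_self] at this
      exact ha0 this.symm
    obtain ⟨r, hr, hsub, ε₀, hε₀, hloc⟩ := exists_integral_bumpJac_eq_of_zero hΩ hz₀ dA dB
      (hq.continuousAt (hΩ.mem_nhds hz₀)) (hq1 z₀ hz₀) derB (by
        simp only [hA, hB, map_add, map_neg]
        linear_combination h0) han.continuousAt ha0 hev
    set ε := min ε₀ (((1 - l) / 2) ^ 2) with hε
    have hεp : 0 < ε := lt_min hε₀ hl2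
    obtain ⟨hz1, hint⟩ := global ε hεp (min_le_right _ _)
    have hl1 := hloc ε hεp (min_le_left _ _)
    have hmon := setIntegral_mono_set (μ := volume) (f := bumpJac ε A B) (s := Metric.ball z₀ r)
      (t := Ω) (integrableOn_of_compact hΩ (hcpt _ (by linarith))
        (continuousOn_bumpJac hΩ ε dA dB) hz1 (fun z hz => hz.1))
      ((ae_restrict_iff' hΩ.measurableSet).2 (Eventually.of_forall (nonneg ε)))
      (LE.le.eventuallyLE hsub)
    rw [hint, hl1] at hmon
    have hpi : 0 < π * ε ^ 3 / 3 := by have := Real.pi_pos; positivity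
    have hm' : (1 : ℝ) ≤ m := by exact_mod_cast hm
    nlinarith

/-- The derivative of the inverse of a map whose derivative is bounded below. -/
lemma hasDerivAt_comp_inverse {ζ F X : ℂ → ℂ} {y c : ℂ} {L M : ℂ →L[ℝ] ℂ} {Ω : Set ℂ}
    (hΩ : Ω ∈ 𝓝 y) (hF : LipschitzOnWith 1 F Ω) (hζ : HasFDerivAt ζ L (F y))
    (hX : HasFDerivAt X M (F y)) (hinv : ∀ x ∈ Ω, ζ (F x) = x) (hM : ∀ v, M v = c * L v) :
    HasDerivAt (fun x => X (F x)) c y := by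
  have hy := mem_of_mem_nhds hΩ
  have hlip : (fun x => F x - F y) =O[𝓝 y] fun x => x - y := by
    refine Asymptotics.IsBigO.of_bound 1 ?_
    filter_upwards [hΩ] with x hx
    simpa [dist_eq_norm] using hF.dist_le_mul x hx y hy
  have hcont : Tendsto F (𝓝 y) (𝓝 (F y)) := (hF.continuousOn.continuousAt hΩ)
  have h1 := (hX.isLittleO.comp_tendsto hcont).trans_isBigO hlip
  have h2 := ((hζ.isLittleO.comp_tendsto hcont).trans_isBigO hlip).const_mul_left c
  rw [hasDerivAt_iff_isLittleO]
  refine (h1.sub h2).congr' ?_ EventuallyEq.rfl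
  filter_upwards [hΩ] with x hx
  simp only [Function.comp_apply, hinv x hx, hinv y hy, hM, smul_eq_mul]
  ring

/-- A `C¹` map of the disk whose differential dominates the identity is a diffeomorphism onto an
open set, with nonexpanding inverse. -/
theorem exists_inverse_of_monotone {ζ : ℂ → ℂ} {L : ℂ → ℂ →L[ℝ] ℂ}
    (hζ : ∀ z ∈ Metric.ball (0 : ℂ) 1, HasFDerivAt ζ (L z) z)
    (hL : ContinuousOn L (Metric.ball 0 1))
    (hpos : ∀ z ∈ Metric.ball (0 : ℂ) 1, ∀ v, Complex.normSq v ≤ (conj v * L z v).re) :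
    ∃ F : ℂ → ℂ, IsOpen (ζ '' Metric.ball 0 1) ∧ IsPreconnected (ζ '' Metric.ball 0 1) ∧
      LipschitzOnWith 1 F (ζ '' Metric.ball 0 1) ∧
      (∀ y ∈ ζ '' Metric.ball 0 1, ζ (F y) = y) ∧ F '' (ζ '' Metric.ball 0 1) = Metric.ball 0 1 ∧
      (∀ r < 1, IsCompact {y ∈ ζ '' Metric.ball 0 1 | ‖F y‖ ≤ r}) := by
  have hcont : ContinuousOn ζ (Metric.ball 0 1) := fun z hz =>
    (hζ z hz).continuousAt.continuousWithinAt
  have hexp : ∀ x ∈ Metric.ball (0 : ℂ) 1, ∀ y ∈ Metric.ball (0 : ℂ) 1,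
      ‖x - y‖ ≤ ‖ζ x - ζ y‖ := by
    intro x hx y hy
    set v := x - y with hv
    have hseg : ∀ τ ∈ Icc (0 : ℝ) 1, y + τ * v ∈ Metric.ball (0 : ℂ) 1 := by
      intro τ hτ
      have := (convex_ball (0 : ℂ) 1).add_smul_sub_mem hy hx hτ
      simpa using this
    have hd : ∀ τ ∈ Icc (0 : ℝ) 1, HasDerivAt (fun τ : ℝ => (conj v * ζ (y + τ * v)).re)
        ((conj v * L (y + τ * v) v).re) τ := by
      intro τ hτ
      have h1 : HasDerivAt (fun τ : ℝ => y + (τ : ℂ) * v) v τ := by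
        have := ((hasDerivAt_id τ).ofReal_comp.mul_const v).const_add y
        simpa using this
      have h2 := ((hζ _ (hseg τ hτ)).comp_hasDerivAt τ h1).const_mul (conj v)
      have h3 := Complex.reCLM.hasFDerivAt.comp_hasDerivAt τ h2
      exact h3
    obtain ⟨τ, hτ, he⟩ := exists_hasDerivAt_eq_slope
      (fun τ : ℝ => (conj v * ζ (y + τ * v)).re) _ one_pos
      (fun τ hτ => (hd τ hτ).continuousAt.continuousWithinAt)
      (fun τ hτ => hd τ ⟨hτ.1.le, hτ.2.le⟩)
    have h4 := hpos _ (hseg τ ⟨hτ.1.le, hτ.2.le⟩) v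
    rw [he] at h4
    have h5 : Complex.normSq v ≤ (conj v * (ζ x - ζ y)).re := by
      refine h4.trans (le_of_eq ?_)
      simp only [Complex.ofReal_one, one_mul, Complex.ofReal_zero, zero_mul, add_zero, sub_zero,
        div_one, mul_sub, Complex.sub_re, hv, add_sub_cancel]
    have h6 : (conj v * (ζ x - ζ y)).re ≤ ‖v‖ * ‖ζ x - ζ y‖ := by
      refine (Complex.re_le_norm _).trans ?_
      rw [norm_mul, RCLike.norm_conj]
    rw [Complex.normSq_eq_norm_sq] at h5
    rcases (norm_nonneg v).eq_or_lt with h0 | h0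
    · rw [← h0]; exact norm_nonneg _
    · have : ‖v‖ * ‖v‖ ≤ ‖v‖ * ‖ζ x - ζ y‖ := by nlinarith
      exact le_of_mul_le_mul_left this h0
  have hinj : InjOn ζ (Metric.ball 0 1) := by
    intro x hx y hy hxy
    have := hexp x hx y hy
    rw [hxy, sub_self, norm_zero] at this
    exact sub_eq_zero.1 (norm_le_zero_iff.1 this)
  have hFζ : ∀ z ∈ Metric.ball (0 : ℂ) 1, Function.invFunOn ζ (Metric.ball 0 1) (ζ z) = z :=
    fun z hz => hinj.leftInvOn_invFunOn hz
  refine ⟨Function.invFunOn ζ (Metric.ball 0 1), ?_,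
    (convex_ball (0 : ℂ) 1).isPreconnected.image ζ hcont, ?_, ?_, ?_, ?_⟩
  · rw [isOpen_iff_mem_nhds]
    rintro _ ⟨z, hz, rfl⟩
    have hstrict : HasStrictFDerivAt ζ (L z) z :=
      hasStrictFDerivAt_of_hasFDerivAt_of_continuousAt
        (by filter_upwards [Metric.isOpen_ball.mem_nhds hz] with w hw using hζ w hw)
        (hL.continuousAt (Metric.isOpen_ball.mem_nhds hz))
    have hinjL : Function.Injective (L z : ℂ →ₗ[ℝ] ℂ) := by
      rw [← LinearMap.ker_eq_bot, LinearMap.ker_eq_bot']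
      intro v hv
      have := hpos z hz v
      rw [show L z v = 0 from hv, mul_zero, Complex.zero_re] at this
      exact Complex.normSq_eq_zero.1 (le_antisymm this (Complex.normSq_nonneg v))
    have hsurj : Function.Surjective (L z : ℂ →ₗ[ℝ] ℂ) := LinearMap.injective_iff_surjective.1 hinjL
    have := hstrict.map_nhds_eq_of_surj (LinearMap.range_eq_top.2 hsurj)
    rw [← this]
    exact image_mem_map (Metric.isOpen_ball.mem_nhds hz)
  · refine LipschitzOnWith.of_dist_le_mul ?_
    rintro _ ⟨x, hx, rfl⟩ _ ⟨y, hy, rfl⟩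
    rw [hFζ x hx, hFζ y hy, dist_eq_norm, dist_eq_norm, NNReal.coe_one, one_mul]
    exact hexp x hx y hy
  · rintro _ ⟨x, hx, rfl⟩
    rw [hFζ x hx]
  · rw [image_image]
    exact (image_congr hFζ).trans (image_id' _)
  · intro r hr
    have : {y ∈ ζ '' Metric.ball 0 1 | ‖Function.invFunOn ζ (Metric.ball 0 1) y‖ ≤ r}
        = ζ '' Metric.closedBall 0 r := by
      ext y
      constructor
      · rintro ⟨⟨x, hx, rfl⟩, hy⟩
        rw [hFζ x hx] at hy
        exact ⟨x, by simpa using hy, rfl⟩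
      · rintro ⟨x, hx, rfl⟩
        have hx' := Metric.closedBall_subset_ball hr hx
        refine ⟨⟨x, hx', rfl⟩, ?_⟩
        rw [hFζ x hx']
        simpa using hx
    rw [this]
    exact (isCompact_closedBall 0 r).image_of_continuousOn
      (hcont.mono (Metric.closedBall_subset_ball hr))

/-- The real linear form with the given partial derivatives. -/
noncomputable def coordForm (a b : ℝ) : ℂ →L[ℝ] ℝ := a • Complex.reCLM + b • Complex.imCLM

@[simp] lemma coordForm_apply (a b : ℝ) (v : ℂ) : coordForm a b v = a * v.re + b * v.im := rfl

/-- The area element of a graph with gradient `(p, q)`. -/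
noncomputable def areaElt (p q : ℝ) : ℝ := √(1 + p ^ 2 + q ^ 2)

lemma areaElt_sq (p q : ℝ) : areaElt p q ^ 2 = 1 + p ^ 2 + q ^ 2 := Real.sq_sqrt (by positivity)

lemma one_le_areaElt (p q : ℝ) : 1 ≤ areaElt p q := by
  rw [areaElt, Real.one_le_sqrt]
  nlinarith [sq_nonneg p, sq_nonneg q]

/-- The symmetric endomorphism with matrix `(a, b; b, d)`. -/
noncomputable def symmForm (a b d : ℝ) : ℂ →L[ℝ] ℂ :=
  a • Complex.reCLM.smulRight (1 : ℂ)
    + b • (Complex.imCLM.smulRight (1 : ℂ) + Complex.reCLM.smulRight Complex.I)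
    + d • Complex.imCLM.smulRight Complex.I

lemma symmForm_apply (a b d : ℝ) (v : ℂ) :
    symmForm a b d v = ⟨a * v.re + b * v.im, b * v.re + d * v.im⟩ := by
  apply Complex.ext <;> simp [symmForm]

/-- The normalised metric of a graph with gradient `(p, q)`. -/
noncomputable def unitMetric (p q : ℝ) : ℂ →L[ℝ] ℂ :=
  symmForm ((1 + p ^ 2) / areaElt p q) (p * q / areaElt p q) ((1 + q ^ 2) / areaElt p q)

/-- A square root of the second dilatation of a graph with gradient `(p, q)`. -/
noncomputable def dilatationRoot (p q : ℝ) : ℂ :=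
  ⟨q / (1 + areaElt p q), p / (1 + areaElt p q)⟩

lemma normSq_dilatationRoot (p q : ℝ) :
    Complex.normSq (dilatationRoot p q) = (areaElt p q - 1) / (areaElt p q + 1) := by
  have h := areaElt_sq p q
  have h1 := one_le_areaElt p q
  have h2 : 1 + areaElt p q ≠ 0 := by linarith
  have h3 : areaElt p q + 1 ≠ 0 := by linarith
  rw [dilatationRoot, Complex.normSq_mk]
  field_simp
  linear_combination (-(1 + areaElt p q)) * h

lemma le_unitMetric (p q : ℝ) (v : ℂ) :
    0 ≤ (conj v * unitMetric p q v).re := by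
  have h1 := one_le_areaElt p q
  rw [unitMetric, symmForm_apply]
  simp only [Complex.mul_re, Complex.conj_re, Complex.conj_im]
  have : v.re * ((1 + p ^ 2) / areaElt p q * v.re + p * q / areaElt p q * v.im) -
      -v.im * (p * q / areaElt p q * v.re + (1 + q ^ 2) / areaElt p q * v.im)
      = (v.re ^ 2 + v.im ^ 2 + (p * v.re + q * v.im) ^ 2) / areaElt p q := by
    field_simp
    ring
  rw [this]
  positivity

lemma conj_sub_unitMetric (p q : ℝ) (v : ℂ) :
    conj (v - unitMetric p q v) = dilatationRoot p q ^ 2 * (v + unitMetric p q v) := by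
  have h := areaElt_sq p q
  have h1 := one_le_areaElt p q
  have h0 : areaElt p q ≠ 0 := by linarith
  have h2 : 1 + areaElt p q ≠ 0 := by linarith
  rw [unitMetric, symmForm_apply, dilatationRoot]
  set W := areaElt p q
  apply Complex.ext
  · simp [pow_two]
    field_simp
    linear_combination (v.re * (W + 1 - p ^ 2) - v.im * p * q) * h
  · simp [pow_two]
    field_simp
    linear_combination (-v.im * (W + 1 - q ^ 2) + v.re * p * q) * h

variable {P Q : ℂ → ℝ} {r s t : ℝ} {z : ℂ}

lemma hasFDerivAt_areaElt (hP : HasFDerivAt P (coordForm r s) z)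
    (hQ : HasFDerivAt Q (coordForm s t) z) :
    HasFDerivAt (fun z => areaElt (P z) (Q z))
      (coordForm ((P z * r + Q z * s) / areaElt (P z) (Q z))
        ((P z * s + Q z * t) / areaElt (P z) (Q z))) z := by
  have h := (((hP.pow 2).const_add 1).add (hQ.pow 2)).sqrt
    (show 1 + P z ^ 2 + Q z ^ 2 ≠ 0 by positivity)
  refine h.congr_fderiv ?_
  have h1 := one_le_areaElt (P z) (Q z)
  have h1' : areaElt (P z) (Q z) ≠ 0 := by linarith
  ext v
  have e : √(1 + P z ^ 2 + Q z ^ 2) = areaElt (P z) (Q z) := rfl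
  simp [e]
  field_simp
  ring

lemma hasFDerivAt_div_areaElt {X : ℂ → ℝ} {x y : ℝ} (hP : HasFDerivAt P (coordForm r s) z)
    (hQ : HasFDerivAt Q (coordForm s t) z) (hX : HasFDerivAt X (coordForm x y) z) (κ : ℝ)
    (hκ : 0 ≤ κ) :
    HasFDerivAt (fun z => X z / (κ + areaElt (P z) (Q z)))
      (coordForm
        (x / (κ + areaElt (P z) (Q z)) - X z * (P z * r + Q z * s) / (areaElt (P z) (Q z) *
          (κ + areaElt (P z) (Q z)) ^ 2))
        (y / (κ + areaElt (P z) (Q z)) - X z * (P z * s + Q z * t) / (areaElt (P z) (Q z) *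
          (κ + areaElt (P z) (Q z)) ^ 2))) z := by
  have h1 := one_le_areaElt (P z) (Q z)
  have h0 : areaElt (P z) (Q z) ≠ 0 := by linarith
  have h2 : κ + areaElt (P z) (Q z) ≠ 0 := by linarith
  have h := hX.mul ((hasDerivAt_inv h2).comp_hasFDerivAt z ((hasFDerivAt_areaElt hP hQ).const_add κ))
  refine h.congr_fderiv ?_
  ext v
  simp
  field_simp
  ring

lemma ofReal_coordForm_apply (x₁ x₂ y₁ y₂ : ℝ) (v : ℂ) :
    (Complex.ofRealCLM ∘SL coordForm x₁ x₂ + Complex.I • Complex.ofRealCLM ∘SL coordForm y₁ y₂) v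
      = v.re * ⟨x₁, y₁⟩ + v.im * ⟨x₂, y₂⟩ := by
  apply Complex.ext <;> simp <;> ring

/-- The Gauss map of a minimal graph is conformal for the normalised metric. -/
lemma hasFDerivAt_dilatationRoot (hP : HasFDerivAt P (coordForm r s) z)
    (hQ : HasFDerivAt Q (coordForm s t) z)
    (hM : (1 + Q z ^ 2) * r - 2 * P z * Q z * s + (1 + P z ^ 2) * t = 0) :
    ∃ M : ℂ →L[ℝ] ℂ, ∃ c : ℂ, HasFDerivAt (fun z => dilatationRoot (P z) (Q z)) M z ∧
      (∀ v, M v = c * (v + unitMetric (P z) (Q z) v)) ∧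
      Complex.normSq c * (1 + areaElt (P z) (Q z)) ^ 4 = s ^ 2 - r * t := by
  have hX := hasFDerivAt_div_areaElt hP hQ hQ 1 zero_le_one
  have hY := hasFDerivAt_div_areaElt hP hQ hP 1 zero_le_one
  have h := areaElt_sq (P z) (Q z)
  have h1 := one_le_areaElt (P z) (Q z)
  have h0 : areaElt (P z) (Q z) ≠ 0 := by linarith
  have h2 : 1 + areaElt (P z) (Q z) ≠ 0 := by linarith
  have hdil : (fun z => dilatationRoot (P z) (Q z)) = fun z =>
      Complex.ofRealCLM (Q z / (1 + areaElt (P z) (Q z)))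
        + Complex.ofRealCLM (P z / (1 + areaElt (P z) (Q z))) * Complex.I := by
    funext w
    exact Complex.mk_eq_add_mul_I _ _
  rw [hdil]
  have hM' := (Complex.ofRealCLM.hasFDerivAt.comp z hX).add
    ((Complex.ofRealCLM.hasFDerivAt.comp z hY).mul_const Complex.I)
  rw [unitMetric]
  set W := areaElt (P z) (Q z)
  set p := P z
  set q := Q z
  have hW : W * (1 + W) ^ 2 ≠ 0 := by positivity
  have eX1 : s / (1 + W) - q * (p * r + q * s) / (W * (1 + W) ^ 2)
      = (s * (W + 1 + p ^ 2) - p * q * r) / (W * (1 + W) ^ 2) := by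
    field_simp
    linear_combination s * h
  have eX2 : t / (1 + W) - q * (p * s + q * t) / (W * (1 + W) ^ 2)
      = (t * (W + 1 + p ^ 2) - p * q * s) / (W * (1 + W) ^ 2) := by
    field_simp
    linear_combination t * h
  have eY1 : r / (1 + W) - p * (p * r + q * s) / (W * (1 + W) ^ 2)
      = (r * (W + 1 + q ^ 2) - p * q * s) / (W * (1 + W) ^ 2) := by
    field_simp
    linear_combination r * h
  have eY2 : s / (1 + W) - p * (p * s + q * t) / (W * (1 + W) ^ 2)
      = (s * (W + 1 + q ^ 2) - p * q * t) / (W * (1 + W) ^ 2) := by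
    field_simp
    linear_combination s * h
  rw [eX1, eX2, eY1, eY2] at hM'
  set κ := W * (1 + W) ^ 2 with hκ
  set zu : ℂ := ⟨1 + (1 + p ^ 2) / W, p * q / W⟩ with hzu
  set zv : ℂ := ⟨p * q / W, 1 + (1 + q ^ 2) / W⟩ with hzv
  set cu : ℂ := ⟨(s * (W + 1 + p ^ 2) - p * q * r) / κ,
    (r * (W + 1 + q ^ 2) - p * q * s) / κ⟩ with hcu
  set cv : ℂ := ⟨(t * (W + 1 + p ^ 2) - p * q * s) / κ,
    (s * (W + 1 + q ^ 2) - p * q * t) / κ⟩ with hcv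
  have hzu0 : zu ≠ 0 := by
    intro hcon
    have : zu.re = 0 := by rw [hcon]; rfl
    have h3 : 0 < 1 + (1 + p ^ 2) / W := by positivity
    exact h3.ne' this
  have hcomm : cu * zv = cv * zu := by
    apply Complex.ext
    · simp only [hcu, hcv, hzu, hzv, Complex.mul_re]
      field_simp
      linear_combination (-(W + 1) ^ 2) * hM + (-2 * s * p * q + r * q ^ 2 + t * p ^ 2) * h
    · simp only [hcu, hcv, hzu, hzv, Complex.mul_im]
      field_simp
      ring
  have hcu' : cu / zu * zu = cu := by field_simp
  have hcv' : cu / zu * zv = cv := by rw [div_mul_eq_mul_div, hcomm, mul_div_cancel_right₀ _ hzu0]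
  generalize cu / zu = c at hcu' hcv'
  refine ⟨_, c, hM', ?_, ?_⟩
  · intro v
    have e1 : v + symmForm ((1 + p ^ 2) / W) (p * q / W) ((1 + q ^ 2) / W) v
        = v.re * zu + v.im * zv := by
      rw [symmForm_apply]
      apply Complex.ext <;> simp [hzu, hzv] <;> ring
    have e2 : c * (v.re * zu + v.im * zv) = v.re * cu + v.im * cv := by
      rw [← hcu', ← hcv']; ring
    rw [e1, e2, ofReal_coordForm_apply]
  · have hjac : cu.re * cv.im - cu.im * cv.re
        = Complex.normSq c * (zu.re * zv.im - zu.im * zv.re) := by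
      rw [← hcu', ← hcv']
      simp only [Complex.mul_re, Complex.mul_im, Complex.normSq_apply]
      ring
    have hz : zu.re * zv.im - zu.im * zv.re = (1 + W) ^ 2 / W := by
      simp only [hzu, hzv]
      field_simp
      linear_combination (-1 - W) * h
    have hcc : cu.re * cv.im - cu.im * cv.re = (s ^ 2 - r * t) / κ := by
      simp only [hcu, hcv]
      have : (W + 1 + p ^ 2) * (W + 1 + q ^ 2) - (p * q) ^ 2 = κ := by
        rw [hκ]
        linear_combination (- W - 1) * h
      field_simp
      rw [← this]
      ring
    rw [hz, hcc, hκ] at hjac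
    field_simp at hjac
    rw [hjac]
    ring

lemma hasFDerivAt_symmForm {a b d : ℂ → ℝ} {a' b' d' : ℂ →L[ℝ] ℝ} {z : ℂ}
    (ha : HasFDerivAt a a' z) (hb : HasFDerivAt b b' z) (hd : HasFDerivAt d d' z) :
    HasFDerivAt (fun z => symmForm (a z) (b z) (d z))
      (a'.smulRight (symmForm 1 0 0) + b'.smulRight (symmForm 0 1 0)
        + d'.smulRight (symmForm 0 0 1)) z := by
  have := ((ha.smul_const (symmForm 1 0 0)).add (hb.smul_const (symmForm 0 1 0))).add
    (hd.smul_const (symmForm 0 0 1))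
  refine this.congr_of_eventuallyEq (Eventually.of_forall fun w => ?_)
  ext v
  simp [symmForm_apply]
  apply Complex.ext <;> simp

lemma symmForm_closed {a₁ a₂ b₁ b₂ d₁ d₂ : ℝ} (h₁ : a₂ = b₁) (h₂ : d₁ = b₂) (x y : ℂ) :
    ((coordForm a₁ a₂).smulRight (symmForm 1 0 0) + (coordForm b₁ b₂).smulRight (symmForm 0 1 0)
        + (coordForm d₁ d₂).smulRight (symmForm 0 0 1)) x y
      = ((coordForm a₁ a₂).smulRight (symmForm 1 0 0)
        + (coordForm b₁ b₂).smulRight (symmForm 0 1 0)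
        + (coordForm d₁ d₂).smulRight (symmForm 0 0 1)) y x := by
  subst h₁ h₂
  apply Complex.ext <;> simp [symmForm_apply] <;> ring

/-- The conjugate potential of a minimal graph. -/
theorem exists_hasFDerivAt_unitMetric {P Q r s t : ℂ → ℝ}
    (hP : ∀ z ∈ Metric.ball (0 : ℂ) 1, HasFDerivAt P (coordForm (r z) (s z)) z)
    (hQ : ∀ z ∈ Metric.ball (0 : ℂ) 1, HasFDerivAt Q (coordForm (s z) (t z)) z)
    (hM : ∀ z ∈ Metric.ball (0 : ℂ) 1,
      (1 + Q z ^ 2) * r z - 2 * P z * Q z * s z + (1 + P z ^ 2) * t z = 0) :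
    ContinuousOn (fun z => unitMetric (P z) (Q z)) (Metric.ball 0 1) ∧
    ∃ ω : ℂ → ℂ, ∀ z ∈ Metric.ball (0 : ℂ) 1, HasFDerivAt ω (unitMetric (P z) (Q z)) z := by
  have key : ∀ z ∈ Metric.ball (0 : ℂ) 1, ∃ D : ℂ →L[ℝ] ℂ →L[ℝ] ℂ,
      HasFDerivAt (fun z => unitMetric (P z) (Q z)) D z ∧ ∀ x y, D x y = D y x := by
    intro z hz
    have p := hP z hz
    have q := hQ z hz
    have m := hM z hz
    have a2 : HasFDerivAt (fun z => 1 + P z ^ 2)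
        (coordForm (2 * P z * r z) (2 * P z * s z)) z := by
      refine ((p.pow 2).const_add 1).congr_fderiv ?_
      ext v
      simp
      ring
    have b2 : HasFDerivAt (fun z => P z * Q z)
        (coordForm (r z * Q z + P z * s z) (s z * Q z + P z * t z)) z := by
      refine (p.mul q).congr_fderiv ?_
      ext v
      simp
      ring
    have d2 : HasFDerivAt (fun z => 1 + Q z ^ 2)
        (coordForm (2 * Q z * s z) (2 * Q z * t z)) z := by
      refine ((q.pow 2).const_add 1).congr_fderiv ?_
      ext v
      simp
      ring
    have a3 := hasFDerivAt_div_areaElt p q a2 0 le_rfl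
    have b3 := hasFDerivAt_div_areaElt p q b2 0 le_rfl
    have d3 := hasFDerivAt_div_areaElt p q d2 0 le_rfl
    simp only [zero_add] at a3 b3 d3
    refine ⟨_, hasFDerivAt_symmForm a3 b3 d3, ?_⟩
    intro x y
    have h := areaElt_sq (P z) (Q z)
    have h0 : areaElt (P z) (Q z) ≠ 0 := by linarith [one_le_areaElt (P z) (Q z)]
    set W := areaElt (P z) (Q z)
    have e1 : 2 * P z * s z / W - (1 + P z ^ 2) * (P z * s z + Q z * t z) / (W * W ^ 2)
        = (r z * Q z + P z * s z) / W - P z * Q z * (P z * r z + Q z * s z) / (W * W ^ 2) := by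
      field_simp
      linear_combination (-Q z) * m + (P z * s z - Q z * r z) * h
    have e2 : 2 * Q z * s z / W - (1 + Q z ^ 2) * (P z * r z + Q z * s z) / (W * W ^ 2)
        = (s z * Q z + P z * t z) / W - P z * Q z * (P z * s z + Q z * t z) / (W * W ^ 2) := by
      field_simp
      linear_combination (-P z) * m + (Q z * s z - P z * t z) * h
    exact symmForm_closed e1 e2 x y
  refine ⟨fun z hz => ?_, ?_⟩
  · obtain ⟨D, hD, -⟩ := key z hz
    exact hD.continuousAt.continuousWithinAt
  · refine (convex_ball (0 : ℂ) 1).exists_forall_hasFDerivAt_of_fderiv_symmetric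
      Metric.isOpen_ball ?_ ?_
    · intro z hz
      obtain ⟨D, hD, -⟩ := key z hz
      exact hD.differentiableAt.differentiableWithinAt
    · intro z hz x y
      obtain ⟨D, hD, hs⟩ := key z hz
      rw [hD.fderiv]
      exact hs x y

/-- Harmonic parametrisation of a minimal graph over the disk. -/
theorem exists_harmonic_parametrisation {P Q r s t : ℂ → ℝ}
    (hP : ∀ z ∈ Metric.ball (0 : ℂ) 1, HasFDerivAt P (coordForm (r z) (s z)) z)
    (hQ : ∀ z ∈ Metric.ball (0 : ℂ) 1, HasFDerivAt Q (coordForm (s z) (t z)) z)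
    (hM : ∀ z ∈ Metric.ball (0 : ℂ) 1,
      (1 + Q z ^ 2) * r z - 2 * P z * Q z * s z + (1 + P z ^ 2) * t z = 0) :
    ∃ (Ω : Set ℂ) (h g q : ℂ → ℂ) (z₀ : ℂ), IsOpen Ω ∧ IsPreconnected Ω ∧
      DifferentiableOn ℂ h Ω ∧ DifferentiableOn ℂ g Ω ∧ DifferentiableOn ℂ q Ω ∧
      (∀ z ∈ Ω, ‖q z‖ < 1) ∧ (∀ z ∈ Ω, deriv h z = 1 / 2) ∧
      (∀ z ∈ Ω, deriv g z = q z ^ 2 * deriv h z) ∧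
      InjOn (fun z => h z + conj (g z)) Ω ∧
      (fun z => h z + conj (g z)) '' Ω = Metric.ball 0 1 ∧
      (∀ ρ < 1, IsCompact {z ∈ Ω | ‖h z + conj (g z)‖ ≤ ρ}) ∧ z₀ ∈ Ω ∧
      h z₀ + conj (g z₀) = 0 ∧
      16 * ‖deriv q z₀‖ ^ 2
        = (s 0 ^ 2 - r 0 * t 0) / (1 + P 0 ^ 2 + Q 0 ^ 2) * (1 - ‖q z₀‖ ^ 4) ^ 2 := by
  obtain ⟨hcont, ω, hω⟩ := exists_hasFDerivAt_unitMetric hP hQ hM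
  set ζ : ℂ → ℂ := fun z => z + ω z with hζdef
  have hζ : ∀ z ∈ Metric.ball (0 : ℂ) 1,
      HasFDerivAt ζ (ContinuousLinearMap.id ℝ ℂ + unitMetric (P z) (Q z)) z := fun z hz =>
    (hasFDerivAt_id z).add (hω z hz)
  obtain ⟨F, hopen, hconn, hlip, hinv, himg, hcpt⟩ := exists_inverse_of_monotone hζ
    (continuousOn_const.add hcont) (fun z _ v => by
      have h1 := le_unitMetric (P z) (Q z) v
      have h2 : (conj v * v).re = Complex.normSq v := by
        rw [← Complex.normSq_eq_conj_mul_self, Complex.ofReal_re]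
      simp only [add_apply, ContinuousLinearMap.id_apply, mul_add,
        Complex.add_re]
      linarith)
  set Ω := ζ '' Metric.ball 0 1 with hΩ
  have hFmem : ∀ y ∈ Ω, F y ∈ Metric.ball (0 : ℂ) 1 := fun y hy => by
    rw [← himg]; exact mem_image_of_mem F hy
  have hg : ∀ y ∈ Ω, HasDerivAt (fun y => (1 / 2 : ℂ) * conj (F y - ω (F y)))
      (dilatationRoot (P (F y)) (Q (F y)) ^ 2 * (1 / 2)) y := by
    intro y hy
    have hX : HasFDerivAt (fun z => conj (z - ω z))
        (Complex.conjCLE.toContinuousLinearMap ∘L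
          (ContinuousLinearMap.id ℝ ℂ - unitMetric (P (F y)) (Q (F y)))) (F y) :=
      Complex.conjCLE.toContinuousLinearMap.hasFDerivAt.comp _
        ((hasFDerivAt_id _).sub (hω _ (hFmem y hy)))
    have := hasDerivAt_comp_inverse (hopen.mem_nhds hy) hlip (hζ _ (hFmem y hy)) hX hinv
      (fun v => conj_sub_unitMetric (P (F y)) (Q (F y)) v)
    exact (this.const_mul (1 / 2 : ℂ)).congr_deriv (by ring)
  have hq : ∀ y ∈ Ω, ∃ c, HasDerivAt (fun y => dilatationRoot (P (F y)) (Q (F y))) c y ∧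
      Complex.normSq c * (1 + areaElt (P (F y)) (Q (F y))) ^ 4
        = s (F y) ^ 2 - r (F y) * t (F y) := by
    intro y hy
    obtain ⟨M, c, hM1, hM2, hM3⟩ := hasFDerivAt_dilatationRoot (hP _ (hFmem y hy))
      (hQ _ (hFmem y hy)) (hM _ (hFmem y hy))
    exact ⟨c, hasDerivAt_comp_inverse (X := fun z => dilatationRoot (P z) (Q z))
      (hopen.mem_nhds hy) hlip (hζ _ (hFmem y hy)) hM1 hinv
      hM2, hM3⟩
  have hF : ∀ y ∈ Ω, 1 / 2 * y + conj ((1 / 2 : ℂ) * conj (F y - ω (F y))) = F y := by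
    intro y hy
    have h1 : F y + ω (F y) = y := hinv y hy
    simp only [map_mul, Complex.conj_conj, map_div₀, map_one, Complex.conj_ofNat]
    linear_combination (-1 / 2 : ℂ) * h1
  have hh : ∀ y : ℂ, HasDerivAt (fun y => (1 / 2 : ℂ) * y) (1 / 2) y := fun y => by
    simpa using (hasDerivAt_id y).const_mul (1 / 2 : ℂ)
  have h0mem : (0 : ℂ) ∈ Metric.ball (0 : ℂ) 1 := by simp
  obtain ⟨z₀, hz₀, hFz₀⟩ : ∃ z₀ ∈ Ω, F z₀ = 0 := by
    rw [← himg] at h0mem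
    exact h0mem
  refine ⟨Ω, fun y => 1 / 2 * y, fun y => (1 / 2 : ℂ) * conj (F y - ω (F y)),
    fun y => dilatationRoot (P (F y)) (Q (F y)), z₀, hopen, hconn,
    fun y _ => (hh y).differentiableAt.differentiableWithinAt,
    fun y hy => (hg y hy).differentiableAt.differentiableWithinAt,
    fun y hy => ?_, fun y hy => ?_, fun y _ => (hh y).deriv,
    fun y hy => by rw [(hg y hy).deriv, (hh y).deriv], ?_, ?_, ?_, hz₀, ?_, ?_⟩
  · obtain ⟨c, hc, -⟩ := hq y hy
    exact hc.differentiableAt.differentiableWithinAt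
  · have h1 := one_le_areaElt (P (F y)) (Q (F y))
    have h2 := normSq_dilatationRoot (P (F y)) (Q (F y))
    rw [Complex.normSq_eq_norm_sq] at h2
    have h3 : (areaElt (P (F y)) (Q (F y)) - 1) / (areaElt (P (F y)) (Q (F y)) + 1) < 1 := by
      rw [div_lt_one (by linarith)]
      linarith
    rw [← h2] at h3
    exact (sq_lt_one_iff₀ (norm_nonneg _)).1 h3
  · intro x hx y hy hxy
    have hxy' : F x = F y := by rw [← hF x hx, ← hF y hy]; exact hxy
    rw [← hinv x hx, ← hinv y hy, hxy']
  · rw [← himg]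
    exact image_congr hF
  · intro ρ hρ
    convert hcpt ρ hρ using 1
    ext y
    simp only [mem_ofPred_eq]
    constructor
    · rintro ⟨hy, h⟩
      rw [hF y hy] at h
      exact ⟨hy, h⟩
    · rintro ⟨hy, h⟩
      refine ⟨hy, ?_⟩
      rw [hF y hy]
      exact h
  · rw [hF z₀ hz₀, hFz₀]
  · obtain ⟨c, hc, hc2⟩ := hq z₀ hz₀
    have h1 := one_le_areaElt (P (F z₀)) (Q (F z₀))
    have h2 := normSq_dilatationRoot (P (F z₀)) (Q (F z₀))
    have h3 := areaElt_sq (P (F z₀)) (Q (F z₀))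
    rw [hc.deriv]
    beta_reduce
    rw [hFz₀] at h1 h2 h3 hc2 ⊢
    rw [Complex.normSq_eq_norm_sq] at h2 hc2
    have h4 : ‖dilatationRoot (P 0) (Q 0)‖ ^ 4 = ((areaElt (P 0) (Q 0) - 1) /
        (areaElt (P 0) (Q 0) + 1)) ^ 2 := by rw [← h2]; ring
    rw [h4, ← h3, ← hc2]
    have h5 : areaElt (P 0) (Q 0) ≠ 0 := by linarith
    have h6 : areaElt (P 0) (Q 0) + 1 ≠ 0 := by linarith
    field_simp
    ring

lemma pu_eq_fderiv {g : ℝ × ℝ → ℝ} {p : ℝ × ℝ} (hg : DifferentiableAt ℝ g p) :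
    pu g p = fderiv ℝ g p (1, 0) := by
  have h : HasDerivAt (fun u : ℝ => (u, p.2)) ((1 : ℝ), (0 : ℝ)) p.1 :=
    (hasDerivAt_id p.1).prodMk (hasDerivAt_const p.1 p.2)
  exact (HasFDerivAt.comp_hasDerivAt (f := fun u : ℝ => (u, p.2)) p.1 hg.hasFDerivAt h).deriv

lemma pv_eq_fderiv {g : ℝ × ℝ → ℝ} {p : ℝ × ℝ} (hg : DifferentiableAt ℝ g p) :
    pv g p = fderiv ℝ g p (0, 1) := by
  have h : HasDerivAt (fun v : ℝ => (p.1, v)) ((0 : ℝ), (1 : ℝ)) p.2 :=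
    (hasDerivAt_const p.2 p.1).prodMk (hasDerivAt_id p.2)
  exact (HasFDerivAt.comp_hasDerivAt (f := fun v : ℝ => (p.1, v)) p.2 hg.hasFDerivAt h).deriv

lemma isOpen_unitDisk : IsOpen unitDisk :=
  isOpen_lt (by fun_prop) continuous_const

lemma mk_mem_unitDisk {z : ℂ} (hz : z ∈ Metric.ball (0 : ℂ) 1) : (z.re, z.im) ∈ unitDisk := by
  have h : ‖z‖ < 1 := by simpa using hz
  have h2 : Complex.normSq z < 1 := by
    rw [Complex.normSq_eq_norm_sq]
    exact pow_lt_one₀ (norm_nonneg _) h two_ne_zero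
  rw [Complex.normSq_apply] at h2
  change z.re ^ 2 + z.im ^ 2 < 1
  linarith

lemma hasFDerivAt_comp_re_im {g : ℝ × ℝ → ℝ} {z : ℂ}
    (hg : DifferentiableAt ℝ g (z.re, z.im)) :
    HasFDerivAt (fun z : ℂ => g (z.re, z.im))
      (coordForm (pu g (z.re, z.im)) (pv g (z.re, z.im))) z := by
  rw [pu_eq_fderiv hg, pv_eq_fderiv hg]
  have h : HasFDerivAt (fun z : ℂ => (z.re, z.im)) (Complex.reCLM.prod Complex.imCLM) z :=
    Complex.reCLM.hasFDerivAt.prodMk Complex.imCLM.hasFDerivAt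
  refine (HasFDerivAt.comp (f := fun z : ℂ => (z.re, z.im)) z hg.hasFDerivAt h).congr_fderiv ?_
  ext v
  have : (v.re, v.im) = v.re • ((1 : ℝ), (0 : ℝ)) + v.im • ((0 : ℝ), (1 : ℝ)) := by simp
  simp only [ContinuousLinearMap.comp_apply, ContinuousLinearMap.prod_apply, Complex.reCLM_apply,
    Complex.imCLM_apply, coordForm_apply]
  rw [this, map_add, map_smul, map_smul, smul_eq_mul, smul_eq_mul]
  ring

/-- Second-order calculus of a `C²` function on the disk. -/
lemma second_order_of_contDiffOn {f : ℝ × ℝ → ℝ} (hf : ContDiffOn ℝ 2 f unitDisk) {p : ℝ × ℝ}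
    (hp : p ∈ unitDisk) :
    DifferentiableAt ℝ (pu f) p ∧ DifferentiableAt ℝ (pv f) p ∧ pu (pv f) p = pv (pu f) p := by
  have hmem : unitDisk ∈ 𝓝 p := isOpen_unitDisk.mem_nhds hp
  have hd : ∀ x ∈ unitDisk, DifferentiableAt ℝ f x := fun x hx =>
    (hf.differentiableOn two_ne_zero).differentiableAt (isOpen_unitDisk.mem_nhds hx)
  have hfd : DifferentiableAt ℝ (fderiv ℝ f) p :=
    ((hf.fderiv_of_isOpen (m := 1) isOpen_unitDisk (by norm_num)).differentiableOn
      one_ne_zero).differentiableAt hmem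
  have eu : pu f =ᶠ[𝓝 p] fun x => fderiv ℝ f x (1, 0) := by
    filter_upwards [hmem] with x hx using pu_eq_fderiv (hd x hx)
  have ev : pv f =ᶠ[𝓝 p] fun x => fderiv ℝ f x (0, 1) := by
    filter_upwards [hmem] with x hx using pv_eq_fderiv (hd x hx)
  have du : HasFDerivAt (pu f) ((ContinuousLinearMap.apply ℝ ℝ ((1 : ℝ), (0 : ℝ))).comp
      (fderiv ℝ (fderiv ℝ f) p)) p :=
    ((ContinuousLinearMap.hasFDerivAt _).comp p hfd.hasFDerivAt).congr_of_eventuallyEq eu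
  have dv : HasFDerivAt (pv f) ((ContinuousLinearMap.apply ℝ ℝ ((0 : ℝ), (1 : ℝ))).comp
      (fderiv ℝ (fderiv ℝ f) p)) p :=
    ((ContinuousLinearMap.hasFDerivAt _).comp p hfd.hasFDerivAt).congr_of_eventuallyEq ev
  refine ⟨du.differentiableAt, dv.differentiableAt, ?_⟩
  rw [pu_eq_fderiv dv.differentiableAt, pv_eq_fderiv du.differentiableAt, du.fderiv, dv.fderiv]
  have hs : IsSymmSndFDerivAt ℝ f p := (hf.contDiffAt hmem).isSymmSndFDerivAt (by simp)
  exact hs _ _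

/-- Harmonic parametrisation of a minimal graph over the disk. -/
theorem IsMinimalGraph.exists_harmonic_parametrisation {f : ℝ × ℝ → ℝ} (hf : IsMinimalGraph f) :
    ∃ (Ω : Set ℂ) (h g q : ℂ → ℂ) (z₀ : ℂ), IsOpen Ω ∧ IsPreconnected Ω ∧
      DifferentiableOn ℂ h Ω ∧ DifferentiableOn ℂ g Ω ∧ DifferentiableOn ℂ q Ω ∧
      (∀ z ∈ Ω, ‖q z‖ < 1) ∧ (∀ z ∈ Ω, deriv h z = 1 / 2) ∧
      (∀ z ∈ Ω, deriv g z = q z ^ 2 * deriv h z) ∧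
      InjOn (fun z => h z + conj (g z)) Ω ∧
      (fun z => h z + conj (g z)) '' Ω = Metric.ball 0 1 ∧
      (∀ ρ < 1, IsCompact {z ∈ Ω | ‖h z + conj (g z)‖ ≤ ρ}) ∧ z₀ ∈ Ω ∧
      h z₀ + conj (g z₀) = 0 ∧
      16 * ‖deriv q z₀‖ ^ 2
        = |pu (pu f) (0, 0) * pv (pv f) (0, 0) - (pv (pu f) (0, 0)) ^ 2|
          / (1 + (pu f (0, 0)) ^ 2 + (pv f (0, 0)) ^ 2) * (1 - ‖q z₀‖ ^ 4) ^ 2 := by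
  obtain ⟨Ω, h, g, q, z₀, h1, h2, h3, h4, h5, h6, h7, h8, h9, h10, h11, h12, h13, h14⟩ :=
    _root_.exists_harmonic_parametrisation
    (P := fun z => pu f (z.re, z.im)) (Q := fun z => pv f (z.re, z.im))
    (r := fun z => pu (pu f) (z.re, z.im)) (s := fun z => pv (pu f) (z.re, z.im))
    (t := fun z => pv (pv f) (z.re, z.im))
    (fun z hz => hasFDerivAt_comp_re_im (second_order_of_contDiffOn hf.1 (mk_mem_unitDisk hz)).1)
    (fun z hz => by
      obtain ⟨-, h2, h3⟩ := second_order_of_contDiffOn hf.1 (mk_mem_unitDisk hz)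
      have := hasFDerivAt_comp_re_im h2
      rwa [h3] at this)
    (fun z hz => hf.2 _ (mk_mem_unitDisk hz))
  refine ⟨Ω, h, g, q, z₀, h1, h2, h3, h4, h5, h6, h7, h8, h9, h10, h11, h12, h13, ?_⟩
  simp only [Complex.zero_re, Complex.zero_im] at h14
  rw [h14]
  generalize pu f (0, 0) = p at h14 ⊢
  generalize pv f (0, 0) = w at h14 ⊢
  have hq : 0 < 1 - ‖q z₀‖ ^ 4 :=
    sub_pos.2 (pow_lt_one₀ (norm_nonneg _) (h6 z₀ h12) four_ne_zero)
  have hs := nonneg_of_mul_nonneg_left (h14.symm.trans_ge (by positivity)) (pow_pos hq 2)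
  rw [abs_sub_comm, abs_of_nonneg]
  by_contra! h
  exact absurd hs (not_le.2 (div_neg_of_neg_of_pos h (by positivity)))

lemma abs_mul_two_sub_sq_le {m : ℝ} (hm : m ^ 2 ≤ 2) : m * (2 - m ^ 2) ≤ 1.089 := by
  refine abs_le_of_sq_le_sq' ?_ (by norm_num) |>.2
  have : (m * (2 - m ^ 2)) ^ 2 = 32 / 27 - (m ^ 2 - 2 / 3) ^ 2 * (8 / 3 - m ^ 2) := by ring
  rw [this]
  have := mul_nonneg (sq_nonneg (m ^ 2 - 2 / 3)) (by linarith : (0 : ℝ) ≤ 8 / 3 - m ^ 2)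
  norm_num at this ⊢
  linarith

lemma vertex_distance_le {w D α β E m : ℝ} (hw : 0 ≤ w) (hα : 0 ≤ α) (hαβ : α ≤ β)
    (hβD : 0 < β * D) (hE : (w * (D - β)) ^ 2 ≤ 2 * (β * D) * E) (hm : m ^ 2 ≤ 2) :
    (2 - m ^ 2) * (w - m * α) ^ 2 + (w * m + D + (1 - m ^ 2) * β) ^ 2 ≤
      2 * w ^ 2 + (D + β) ^ 2 + E + 2 * 1.089 * w * (β - α) := by
  have h1 := mul_le_mul_of_nonneg_left (abs_mul_two_sub_sq_le hm)
    (mul_nonneg hw (sub_nonneg.2 hαβ))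
  have h2 : 0 ≤ (β - α) * (α + β) * (m ^ 2 * (2 - m ^ 2)) :=
    mul_nonneg (mul_nonneg (by linarith) (by linarith)) (mul_nonneg (sq_nonneg _) (by linarith))
  have h3 : 2 * w * (D - β) * m - 2 * (β * D) * m ^ 2 ≤ E := by
    by_contra! h
    nlinarith [sq_nonneg (w * (D - β) - 2 * (β * D) * m)]
  linear_combination h3 + 2 * h1 + h2

lemma vertex_distance_le_of_small {w s m : ℝ} (hw : 0.7853 ≤ w) (hw' : w ≤ 0.7854) (hs0 : 0 < s)
    (hs : s ≤ 3 / 10) (hm : m ^ 2 ≤ 2) :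
    (2 - m ^ 2) * (w - m * (s - s ^ 3 / 3)) ^ 2
      + (w * m + 4 / 3 * s * w + (1 - m ^ 2) * (s + s ^ 3 / 3 + 4 / 3 * s * s ^ 2)) ^ 2 ≤
      (1.17 + 2.6 * s ^ 2) ^ 2 := by
  have hs2 : s ^ 2 ≤ 0.09 := by nlinarith
  have hs3 : 0 ≤ s ^ 3 := by positivity
  have hs3' : s ^ 3 ≤ 0.09 * s := by nlinarith
  refine (vertex_distance_le (E := 0.02) (by linarith) (by linarith) (by linarith)
    (by positivity) ?_ hm).trans ?_
  · have h1 : |w * (4 / 3 * s * w - (s + s ^ 3 / 3 + 4 / 3 * s * s ^ 2))| ≤ 0.1 * s := by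
      rw [abs_mul, abs_of_nonneg (by linarith : (0 : ℝ) ≤ w)]
      have : |4 / 3 * s * w - (s + s ^ 3 / 3 + 4 / 3 * s * s ^ 2)| ≤ 0.125 * s := by
        rw [abs_le]; constructor <;> nlinarith
      calc _ ≤ 0.7854 * (0.125 * s) := by gcongr
        _ ≤ _ := by linarith
    have h2 := sq_le_sq' (by linarith [neg_abs_le (w * (4 / 3 * s * w - (s + s ^ 3 / 3 + 4 / 3 * s * s ^ 2)))]) ((le_abs_self _).trans h1)
    have h3 : s * s ≤ (s + s ^ 3 / 3 + 4 / 3 * s * s ^ 2) * (4 / 3 * s * w) := by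
      gcongr
      · nlinarith
      · nlinarith
    nlinarith
  · have e1 : w ^ 2 ≤ 0.61686 := by nlinarith
    have e2 : 4 / 3 * s * w + (s + s ^ 3 / 3 + 4 / 3 * s * s ^ 2) ≤ 2.2 * s := by nlinarith
    have e3 : w * (s + s ^ 3 / 3 + 4 / 3 * s * s ^ 2 - (s - s ^ 3 / 3)) ≤ 0.48 * s ^ 2 := by
      have : w * (s + s ^ 3 / 3 + 4 / 3 * s * s ^ 2 - (s - s ^ 3 / 3)) = w * s * (2 * s ^ 2) := by
        ring
      rw [this]
      have : w * s ≤ 0.24 := by nlinarith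
      nlinarith [sq_nonneg s]
    have e4 : (4 / 3 * s * w + (s + s ^ 3 / 3 + 4 / 3 * s * s ^ 2)) ^ 2 ≤ (2.2 * s) ^ 2 := by
      gcongr
    nlinarith [sq_nonneg s]

lemma vertex_distance_le_of_large {w T m : ℝ} (hw : 0.7853 ≤ w) (hw' : w ≤ 0.7854)
    (hT0 : 0.4 ≤ T) (hT : T ≤ 1) (hm : m ^ 2 ≤ 2) :
    (2 - m ^ 2) * (w - m * 0.291) ^ 2 + (w * m + T * w + (1 - m ^ 2) * (0.309 + 0.09 * T)) ^ 2 ≤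
      (1.153 + 0.634 * T) ^ 2 := by
  refine (vertex_distance_le (E := 0.19 * T) (by linarith) (by linarith) (by linarith)
    (by positivity) ?_ hm).trans ?_
  · have h1 : |w * (T * w - (0.309 + 0.09 * T))| ≤ 0.3037 * T := by
      rw [abs_mul, abs_of_nonneg (by linarith : (0 : ℝ) ≤ w)]
      have : |T * w - (0.309 + 0.09 * T)| ≤ 0.3866 * T := by
        rw [abs_le]; constructor <;> nlinarith
      calc _ ≤ 0.7854 * (0.3866 * T) := by gcongr
        _ ≤ _ := by linarith
    have h2 := sq_le_sq' (by linarith [neg_abs_le (w * (T * w - (0.309 + 0.09 * T)))])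
      ((le_abs_self _).trans h1)
    have h3 : 0.309 * (T * 0.7853) ≤ (0.309 + 0.09 * T) * (T * w) := by
      gcongr
      linarith
    nlinarith
  · have e1 : w ^ 2 ≤ 0.61686 := by nlinarith
    have e2 : T * w + (0.309 + 0.09 * T) ≤ 0.309 + 0.8754 * T := by nlinarith
    have e3 : w * (0.309 + 0.09 * T - 0.291) ≤ 0.7854 * (0.309 + 0.09 * T - 0.291) := by
      gcongr
      linarith
    have e4 : (T * w + (0.309 + 0.09 * T)) ^ 2 ≤ (0.309 + 0.8754 * T) ^ 2 := by gcongr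
    nlinarith [mul_nonneg (sub_nonneg.2 hT0) (sub_nonneg.2 hT)]

/-- The radius of the image of the trial map, before normalisation. -/
lemma vertex_distance_le_radius {T s m : ℝ} (hT0 : 0 ≤ T) (hT : T ≤ 1)
    (hs : s = min (3 / 4 * T) (3 / 10)) (hm : m ^ 2 ≤ 2) :
    √((2 - m ^ 2) * (π / 4 - m * (s - s ^ 3 / 3)) ^ 2
      + (π / 4 * m + T * (π / 4) + (1 - m ^ 2) * (s + s ^ 3 / 3 + T * s ^ 2)) ^ 2)
      + (s ^ 5 + 2 * T * s ^ 6 + s ^ 7) / (1 - s ^ 4) ≤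
      1.175 * ((1 - s ^ 2) * (1 + s ^ 2 + 2 * T * s) / (1 + s ^ 4)) := by
  have hw : 0.7853 ≤ π / 4 := by linarith [pi_gt_d4]
  have hw' : π / 4 ≤ 0.7854 := by linarith [pi_lt_d4]
  generalize π / 4 = w at *
  rcases le_or_gt T 0.4 with h | h
  · rw [min_eq_left (by linarith)] at hs
    obtain rfl : T = 4 / 3 * s := by linarith
    have hs0 : 0 ≤ s := by linarith
    have hs1 : s ≤ 3 / 10 := by linarith
    have hsq : s ^ 2 ≤ 0.09 := by nlinarith
    have h1 : √((2 - m ^ 2) * (w - m * (s - s ^ 3 / 3)) ^ 2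
        + (w * m + 4 / 3 * s * w + (1 - m ^ 2) * (s + s ^ 3 / 3 + 4 / 3 * s * s ^ 2)) ^ 2)
        ≤ 1.17 + 2.6 * s ^ 2 := by
      refine Real.sqrt_le_iff.2 ⟨by positivity, ?_⟩
      rcases hs0.eq_or_lt with rfl | h0
      · nlinarith
      · exact vertex_distance_le_of_small hw hw' h0 hs1 hm
    have h2 : (s ^ 5 + 2 * (4 / 3 * s) * s ^ 6 + s ^ 7) / (1 - s ^ 4) ≤ 0.45 * s ^ 4 := by
      have h4 : s ^ 4 ≤ 0.0081 := by nlinarith [sq_nonneg s]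
      rw [div_le_iff₀ (by linarith)]
      have : s ^ 5 + 2 * (4 / 3 * s) * s ^ 6 + s ^ 7 = s ^ 4 * (s + 11 / 3 * (s * s ^ 2)) := by ring
      rw [this]
      have h5 : s * s ^ 2 ≤ 0.3 * 0.09 := by gcongr; linarith
      have h6 : (0 : ℝ) ≤ s ^ 4 := by positivity
      nlinarith
    have h3 : 1.17 + 2.6 * s ^ 2 + 0.45 * s ^ 4
        ≤ 1.175 * ((1 - s ^ 2) * (1 + s ^ 2 + 2 * (4 / 3 * s) * s) / (1 + s ^ 4)) := by
      rw [← mul_div_assoc, le_div_iff₀ (by positivity)]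
      have : (0 : ℝ) ≤ s ^ 2 := sq_nonneg s
      have e : s ^ 4 = (s ^ 2) ^ 2 := by ring
      have e' : 1 + s ^ 2 + 2 * (4 / 3 * s) * s = 1 + 11 / 3 * s ^ 2 := by ring
      rw [e, e']
      generalize s ^ 2 = u at *
      have hu2 : u ^ 2 ≤ 0.09 * u := by nlinarith
      have hu3 : u ^ 3 ≤ 0.0081 * u := by nlinarith
      have hu4 : u ^ 4 ≤ 0.000729 * u := by nlinarith
      nlinarith
    linarith
  · rw [min_eq_right (by linarith)] at hs
    subst hs
    have h1 : √((2 - m ^ 2) * (w - m * (3 / 10 - (3 / 10) ^ 3 / 3)) ^ 2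
        + (w * m + T * w + (1 - m ^ 2) * (3 / 10 + (3 / 10) ^ 3 / 3 + T * (3 / 10) ^ 2)) ^ 2)
        ≤ 1.153 + 0.634 * T := by
      refine Real.sqrt_le_iff.2 ⟨by positivity, ?_⟩
      convert vertex_distance_le_of_large hw hw' h.le hT hm using 4 <;> ring
    refine (add_le_add_left h1 _).trans ?_
    norm_num
    linarith

/-- A primitive of `1 / (1 - x ^ 4)`. -/
noncomputable def quarticPrim₀ (x : ℂ) : ℂ :=
  (Complex.log (1 + x) - Complex.log (1 - x)) / 4
    + (Complex.log (1 + Complex.I * x) - Complex.log (1 - Complex.I * x)) / (4 * Complex.I)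

/-- A primitive of `x / (1 - x ^ 4)`. -/
noncomputable def quarticPrim₁ (x : ℂ) : ℂ :=
  (Complex.log (1 + Complex.I * x) + Complex.log (1 - Complex.I * x)
    - Complex.log (1 + x) - Complex.log (1 - x)) / 4

/-- A primitive of `x ^ 2 / (1 - x ^ 4)`. -/
noncomputable def quarticPrim₂ (x : ℂ) : ℂ :=
  (Complex.log (1 + x) - Complex.log (1 - x)) / 4
    - (Complex.log (1 + Complex.I * x) - Complex.log (1 - Complex.I * x)) / (4 * Complex.I)

lemma re_one_add_pos {y : ℂ} (hy : ‖y‖ < 1) : 0 < (1 + y).re := by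
  have := (abs_le.1 (Complex.abs_re_le_norm y)).1
  rw [Complex.add_re, Complex.one_re]; linarith

lemma hasDerivAt_log_one_add_mul {k x : ℂ} (hk : ‖k‖ = 1) (hx : ‖x‖ < 1) :
    HasDerivAt (fun x => Complex.log (1 + k * x)) (k / (1 + k * x)) x := by
  have h : HasDerivAt (fun x : ℂ => 1 + k * x) k x := by
    simpa using ((hasDerivAt_id x).const_mul k).const_add 1
  exact h.clog (Or.inl (re_one_add_pos (by simpa [hk] using hx)))

lemma one_add_mul_ne_zero {k x : ℂ} (hk : ‖k‖ = 1) (hx : ‖x‖ < 1) : 1 + k * x ≠ 0 := by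
  intro h
  have := re_one_add_pos (y := k * x) (by simpa [hk] using hx)
  simp [h] at this

lemma hasDerivAt_quarticPrim {x : ℂ} (hx : ‖x‖ < 1) :
    HasDerivAt quarticPrim₀ (1 / (1 - x ^ 4)) x ∧ HasDerivAt quarticPrim₁ (x / (1 - x ^ 4)) x ∧
      HasDerivAt quarticPrim₂ (x ^ 2 / (1 - x ^ 4)) x := by
  have a1 := hasDerivAt_log_one_add_mul (k := 1) (by simp) hx
  have a2 := hasDerivAt_log_one_add_mul (k := -1) (by simp) hx
  have a3 := hasDerivAt_log_one_add_mul (k := Complex.I) (by simp) hx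
  have a4 := hasDerivAt_log_one_add_mul (k := -Complex.I) (by simp) hx
  have n1 := one_add_mul_ne_zero (k := 1) (by simp) hx
  have n2 := one_add_mul_ne_zero (k := -1) (by simp) hx
  have n3 := one_add_mul_ne_zero (k := Complex.I) (by simp) hx
  have n4 := one_add_mul_ne_zero (k := -Complex.I) (by simp) hx
  have hI := Complex.I_sq
  simp only [one_mul, neg_mul, ← sub_eq_add_neg] at a1 a2 a3 a4 n1 n2 n3 n4
  have e1 : (1 + x) * (1 - x) = 1 - x ^ 2 := by ring
  have e2 : (1 + Complex.I * x) * (1 - Complex.I * x) = 1 + x ^ 2 := by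
    linear_combination -x ^ 2 * hI
  have m1 : 1 - x ^ 2 ≠ 0 := e1 ▸ mul_ne_zero n1 n2
  have m2 : 1 + x ^ 2 ≠ 0 := e2 ▸ mul_ne_zero n3 n4
  have e : 1 - x ^ 4 = (1 - x ^ 2) * (1 + x ^ 2) := by ring
  have d1 : 1 / (1 + x) - -1 / (1 - x) = 2 / (1 - x ^ 2) := by
    rw [div_sub_div _ _ n1 n2, e1]; congr 1; ring
  have d2 : 1 / (1 + x) + -1 / (1 - x) = -2 * x / (1 - x ^ 2) := by
    rw [div_add_div _ _ n1 n2, e1]; congr 1; ring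
  have d3 : Complex.I / (1 + Complex.I * x) - -Complex.I / (1 - Complex.I * x)
      = 2 * Complex.I / (1 + x ^ 2) := by
    rw [div_sub_div _ _ n3 n4, e2]; congr 1; ring
  have d4 : Complex.I / (1 + Complex.I * x) + -Complex.I / (1 - Complex.I * x)
      = 2 * x / (1 + x ^ 2) := by
    rw [div_add_div _ _ n3 n4, e2]; congr 1; linear_combination -2 * x * hI
  refine ⟨(((a1.sub a2).div_const 4).add ((a3.sub a4).div_const _)).congr_deriv ?_,
    (((a3.add a4).sub a1).sub a2 |>.div_const 4).congr_deriv ?_,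
    (((a1.sub a2).div_const 4).sub ((a3.sub a4).div_const _)).congr_deriv ?_⟩
  · rw [d1, d3, e]
    field_simp
    ring
  · rw [d4, sub_sub, d2, e]
    field_simp
    ring
  · rw [d1, d3, e]
    field_simp
    ring

/-- Remainder of the Taylor expansion at `0` of a primitive of `x ^ j / (1 - x ^ 4)`. -/
lemma norm_sub_le_of_hasDerivAt_div {K : ℂ → ℂ} {j : ℕ} (h0 : K 0 = 0)
    (hK : ∀ x : ℂ, ‖x‖ < 1 → HasDerivAt K (x ^ j / (1 - x ^ 4)) x) {x : ℂ} (hx : ‖x‖ < 1) :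
    ‖K x - x ^ (j + 1) / (j + 1)‖ ≤ ‖x‖ ^ (j + 5) / (1 - ‖x‖ ^ 4) := by
  have hp : 0 < 1 - ‖x‖ ^ 4 := sub_pos.2 (pow_lt_one₀ (norm_nonneg _) hx four_ne_zero)
  have key := (convex_closedBall (0 : ℂ) ‖x‖).norm_image_sub_le_of_norm_hasDerivWithin_le
    (f := fun y => K y - y ^ (j + 1) / (j + 1)) (f' := fun y => y ^ j / (1 - y ^ 4) - y ^ j)
    (C := ‖x‖ ^ (j + 4) / (1 - ‖x‖ ^ 4)) (x := 0) (y := x) ?_ ?_ (by simp) (by simp)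
  · simpa [h0, div_mul_eq_mul_div, ← pow_succ] using key
  · intro y hy
    have hy1 : ‖y‖ < 1 := (mem_closedBall_zero_iff.1 hy).trans_lt hx
    refine ((hK y hy1).sub (((hasDerivAt_pow (j + 1) y).div_const _).congr_deriv ?_)).hasDerivWithinAt
    have : (j : ℂ) + 1 ≠ 0 := Nat.cast_add_one_ne_zero j
    push_cast
    field_simp
  · intro y hy
    have hy0 : ‖y‖ ≤ ‖x‖ := mem_closedBall_zero_iff.1 hy
    have h1 : 1 - ‖x‖ ^ 4 ≤ ‖1 - y ^ 4‖ := by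
      have := norm_sub_norm_le (1 : ℂ) (y ^ 4)
      rw [norm_one, norm_pow] at this
      have : ‖y‖ ^ 4 ≤ ‖x‖ ^ 4 := by gcongr
      linarith
    have hn : 1 - y ^ 4 ≠ 0 := norm_pos_iff.1 (hp.trans_le h1)
    have : y ^ j / (1 - y ^ 4) - y ^ j = y ^ (j + 4) / (1 - y ^ 4) := by
      field_simp; ring
    rw [this, norm_div, norm_pow]
    gcongr

lemma arg_sub_arg_add_pi_div_four_nonneg {u v : ℂ} (hu : 0 < u.re) (hv : 0 < v.re)
    (h : 0 < (u * conj v * (1 + Complex.I)).im) : 0 ≤ u.arg - v.arg + π / 4 := by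
  by_contra! hneg
  have hu1 := Complex.abs_arg_lt_pi_div_two_iff.2 (Or.inl hu)
  have hv1 := Complex.abs_arg_lt_pi_div_two_iff.2 (Or.inl hv)
  have hs := Real.sin_neg_of_neg_of_neg_pi_lt hneg (by
    have := pi_pos
    linarith [(abs_lt.1 hu1).1, (abs_lt.1 hv1).2])
  rw [Real.sin_add, Real.sin_sub, Real.cos_sub, Real.sin_pi_div_four, Real.cos_pi_div_four] at hs
  have hu2 : 0 < ‖u‖ := hu.trans_le (Complex.re_le_norm u)
  have hv2 : 0 < ‖v‖ := hv.trans_le (Complex.re_le_norm v)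
  have a := Complex.norm_mul_cos_arg u
  have b := Complex.norm_mul_sin_arg u
  have c := Complex.norm_mul_cos_arg v
  have d := Complex.norm_mul_sin_arg v
  simp only [Complex.mul_im, Complex.mul_re, Complex.conj_re, Complex.conj_im, Complex.add_re,
    Complex.add_im, Complex.one_re, Complex.one_im, Complex.I_re, Complex.I_im] at h
  rw [← a, ← b, ← c, ← d] at h
  have : 0 < (‖u‖ * ‖v‖) * (Real.sin u.arg * Real.cos v.arg - Real.cos u.arg * Real.sin v.arg
      + (Real.cos u.arg * Real.cos v.arg + Real.sin u.arg * Real.sin v.arg)) := by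
    linear_combination h
  have := pos_of_mul_pos_right this (by positivity)
  have h2 : 0 < √2 / 2 := by positivity
  nlinarith

/-- The harmonic function `K₀ - conj K₂` and the imaginary part of `K₁` are affine functions of the
four nonnegative weights, of total mass one, built from the arguments of `1 - i ^ k x`. -/
lemma exists_weights_quarticPrim {x : ℂ} (hx : ‖x‖ < 1) :
    ∃ d₀ d₁ d₂ d₃ : ℝ, 0 ≤ d₀ ∧ 0 ≤ d₁ ∧ 0 ≤ d₂ ∧ 0 ≤ d₃ ∧ d₀ + d₁ + d₂ + d₃ = 1 ∧
      quarticPrim₀ x - conj (quarticPrim₂ x) =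
        π / 4 * ((d₀ + d₃ - d₁ - d₂ : ℝ) + (d₂ + d₃ - d₀ - d₁ : ℝ) * Complex.I) ∧
      quarticPrim₁ x - conj (quarticPrim₁ x) =
        (π / 4 * (d₁ + d₃ - d₀ - d₂) : ℝ) * Complex.I := by
  have hI : ∀ {k : ℂ}, ‖k‖ = 1 → 0 < (1 + k * x).re := fun hk =>
    re_one_add_pos (by simpa [hk] using hx)
  have r0 := hI (k := -1) (by simp)
  have r1 := hI (k := -Complex.I) (by simp)
  have r2 := hI (k := 1) (by simp)
  have r3 := hI (k := Complex.I) (by simp)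
  simp only [one_mul, neg_mul, ← sub_eq_add_neg] at r0 r1 r2 r3
  have hn : x.re ^ 2 + x.im ^ 2 < 1 := by
    have := Complex.sq_norm x
    rw [Complex.normSq_apply] at this
    nlinarith [norm_nonneg x]
  have t0 := arg_sub_arg_add_pi_div_four_nonneg r0 r1 (by simp; nlinarith)
  have t1 := arg_sub_arg_add_pi_div_four_nonneg r1 r2 (by simp; nlinarith)
  have t2 := arg_sub_arg_add_pi_div_four_nonneg r2 r3 (by simp; nlinarith)
  have t3 := arg_sub_arg_add_pi_div_four_nonneg r3 r0 (by simp; nlinarith)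
  have hpi := pi_pos
  refine ⟨_, _, _, _, div_nonneg t0 hpi.le, div_nonneg t1 hpi.le, div_nonneg t2 hpi.le,
    div_nonneg t3 hpi.le, by field_simp; ring, ?_, ?_⟩
  · rw [quarticPrim₀, quarticPrim₂]
    have e (y : ℂ) : y / (4 * Complex.I) = -(y * Complex.I / 4) := by
      rw [div_eq_iff (by simp)]; linear_combination y * Complex.I_sq
    rw [e]
    generalize hl0 : Complex.log (1 - x) = l0
    generalize hl1 : Complex.log (1 - Complex.I * x) = l1
    generalize hl2 : Complex.log (1 + x) = l2
    generalize hl3 : Complex.log (1 + Complex.I * x) = l3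
    simp only [← Complex.log_im, hl0, hl1, hl2, hl3]
    apply Complex.ext <;> simp [-map_sub, -map_add, -map_div₀] <;> field_simp <;> ring
  · rw [quarticPrim₁]
    generalize hl0 : Complex.log (1 - x) = l0
    generalize hl1 : Complex.log (1 - Complex.I * x) = l1
    generalize hl2 : Complex.log (1 + x) = l2
    generalize hl3 : Complex.log (1 + Complex.I * x) = l3
    simp only [← Complex.log_im, hl0, hl1, hl2, hl3]
    apply Complex.ext <;> simp [-map_sub, -map_add, -map_div₀] <;> field_simp <;> ring

/-- The combination `ε̄ a₀ + 2 P a₁ + P² ε a₂ - conj (ε a₂ + 2 P a₁ + P² ε̄ a₀)`. -/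
noncomputable def harmonicCombination (P : ℝ) (ε a₀ a₁ a₂ : ℂ) : ℂ :=
  conj ε * a₀ + 2 * P * a₁ + P ^ 2 * ε * a₂ - conj (ε * a₂ + 2 * P * a₁ + P ^ 2 * conj ε * a₀)

lemma harmonicCombination_sub (P : ℝ) (ε a₀ a₁ a₂ b₀ b₁ b₂ : ℂ) :
    harmonicCombination P ε a₀ a₁ a₂ - harmonicCombination P ε b₀ b₁ b₂ =
      harmonicCombination P ε (a₀ - b₀) (a₁ - b₁) (a₂ - b₂) := by
  simp only [harmonicCombination, map_add, map_sub, map_mul]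
  ring

lemma norm_harmonicCombination_le {P T : ℝ} (hP : 0 ≤ P) (hT : 2 * P = T * (1 + P ^ 2)) {ε : ℂ}
    (hε : ‖ε‖ = 1) (a₀ a₁ a₂ : ℂ) :
    ‖harmonicCombination P ε a₀ a₁ a₂‖ ≤ (1 + P ^ 2) * (‖a₀‖ + 2 * T * ‖a₁‖ + ‖a₂‖) := by
  have h1 : ‖conj ε * a₀ + 2 * P * a₁ + P ^ 2 * ε * a₂‖ ≤ ‖a₀‖ + 2 * P * ‖a₁‖ + P ^ 2 * ‖a₂‖ := by
    refine (norm_add₃_le).trans_eq ?_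
    simp [hε, abs_of_nonneg hP]
  have h2 : ‖ε * a₂ + 2 * P * a₁ + P ^ 2 * conj ε * a₀‖ ≤ ‖a₂‖ + 2 * P * ‖a₁‖ + P ^ 2 * ‖a₀‖ := by
    refine (norm_add₃_le).trans_eq ?_
    simp [hε, abs_of_nonneg hP]
  refine (norm_sub_le _ _).trans ?_
  rw [RCLike.norm_conj]
  linear_combination h1 + h2 + 2 * ‖a₁‖ * hT

/-- The values of the trial map at the four vertices of its image. -/
noncomputable def trialVertex (P : ℝ) (ε : ℂ) (σ τ : ℝ) : ℂ :=
  conj ε * (π / 4 * (σ + τ * Complex.I)) - P ^ 2 * conj (conj ε * (π / 4 * (σ + τ * Complex.I)))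
    + 2 * P * ((π / 4 * (σ * τ) : ℝ) * Complex.I)

lemma norm_harmonicCombination_sub_le {P R : ℝ} {ε C x : ℂ}
    (hV : ∀ σ τ : ℝ, σ ^ 2 = 1 → τ ^ 2 = 1 → ‖trialVertex P ε σ τ - C‖ ≤ R) (hx : ‖x‖ < 1) :
    ‖harmonicCombination P ε (quarticPrim₀ x) (quarticPrim₁ x) (quarticPrim₂ x) - C‖ ≤ R := by
  obtain ⟨d₀, d₁, d₂, d₃, h₀, h₁, h₂, h₃, hd, hA, hB⟩ := exists_weights_quarticPrim hx
  have e : harmonicCombination P ε (quarticPrim₀ x) (quarticPrim₁ x) (quarticPrim₂ x) - C =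
      d₀ * (trialVertex P ε 1 (-1) - C) + d₁ * (trialVertex P ε (-1) (-1) - C)
        + d₂ * (trialVertex P ε (-1) 1 - C) + d₃ * (trialVertex P ε 1 1 - C) := by
    have e1 : harmonicCombination P ε (quarticPrim₀ x) (quarticPrim₁ x) (quarticPrim₂ x) =
        conj ε * (quarticPrim₀ x - conj (quarticPrim₂ x))
          - P ^ 2 * conj (conj ε * (quarticPrim₀ x - conj (quarticPrim₂ x)))
          + 2 * P * (quarticPrim₁ x - conj (quarticPrim₁ x)) := by
      simp only [harmonicCombination, map_add, map_sub, map_mul, map_pow, Complex.conj_conj,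
        Complex.conj_ofReal, map_ofNat]
      ring
    have hd' : (d₀ : ℂ) + d₁ + d₂ + d₃ = 1 := by exact_mod_cast hd
    rw [e1, hA, hB]
    simp only [trialVertex, map_add, map_mul, map_div₀, Complex.conj_conj,
      Complex.conj_ofReal, map_ofNat, Complex.conj_I]
    push_cast
    linear_combination C * hd'
  have hn : ∀ d : ℝ, 0 ≤ d → ∀ σ τ : ℝ, σ ^ 2 = 1 → τ ^ 2 = 1 →
      ‖(d : ℂ) * (trialVertex P ε σ τ - C)‖ ≤ d * R := fun d h σ τ hσ hτ => by
    rw [norm_mul, Complex.norm_real, Real.norm_of_nonneg h]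
    exact mul_le_mul_of_nonneg_left (hV σ τ hσ hτ) h
  rw [e]
  refine (norm_add_le_of_le (norm_add_le_of_le (norm_add_le_of_le
    (hn _ h₀ 1 (-1) (by norm_num) (by norm_num))
    (hn _ h₁ (-1) (-1) (by norm_num) (by norm_num))) (hn _ h₂ (-1) 1 (by norm_num) (by norm_num)))
    (hn _ h₃ 1 1 (by norm_num) (by norm_num))).trans_eq ?_
  rw [← add_mul, ← add_mul, ← add_mul, hd, one_mul]

/-- Distance from a vertex to the cubic approximation of the centre. -/
lemma norm_trialVertex_sub_le {P T s σ τ : ℝ} (hT : 2 * P = T * (1 + P ^ 2))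
    {ε : ℂ} (hε : ‖ε‖ = 1) (hσ : σ ^ 2 = 1) (hτ : τ ^ 2 = 1) :
    ∃ m : ℝ, m ^ 2 ≤ 2 ∧
      ‖trialVertex P ε σ τ - harmonicCombination P ε (conj ε * s) ((conj ε * s) ^ 2 / 2)
        ((conj ε * s) ^ 3 / 3)‖ ≤
      (1 + P ^ 2) * √((2 - m ^ 2) * (π / 4 - m * (s - s ^ 3 / 3)) ^ 2
      + (π / 4 * m + T * (π / 4) + (1 - m ^ 2) * (s + s ^ 3 / 3 + T * s ^ 2)) ^ 2) := by
  have hε2 : ε * conj ε = 1 := by rw [Complex.mul_conj, Complex.normSq_eq_norm_sq, hε]; simp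
  have hC : harmonicCombination P ε (conj ε * s) ((conj ε * s) ^ 2 / 2) ((conj ε * s) ^ 3 / 3)
      = conj ε ^ 2 * (s + P * s ^ 2 + P ^ 2 * s ^ 3 / 3)
        - ε ^ 2 * (s ^ 3 / 3 + P * s ^ 2 + P ^ 2 * s) := by
    simp only [harmonicCombination, map_add, map_mul, map_div₀, map_pow, Complex.conj_conj,
      Complex.conj_ofReal, map_ofNat]
    linear_combination (P ^ 2 * s ^ 3 / 3 * conj ε ^ 2 - s ^ 3 / 3 * ε ^ 2) * hε2
  rw [hC]
  obtain ⟨a, b⟩ := ε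
  have hab : a ^ 2 + b ^ 2 = 1 := by
    have := Complex.sq_norm (⟨a, b⟩ : ℂ)
    rw [hε, Complex.normSq_mk] at this
    linarith
  have hστ : (σ * τ) ^ 2 = 1 := by rw [mul_pow, hσ, hτ, one_mul]
  refine ⟨σ * τ * (a * τ - b * σ), ?_, ?_⟩
  · rw [mul_pow, hστ]
    have : (a * τ - b * σ) ^ 2 + (a * σ + b * τ) ^ 2 = 2 := by
      linear_combination (a ^ 2 + b ^ 2) * hτ + (a ^ 2 + b ^ 2) * hσ + 2 * hab
    nlinarith [sq_nonneg (a * σ + b * τ)]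
  have hP : 0 ≤ 1 + P ^ 2 := by positivity
  rw [← Real.sqrt_sq hP, ← Real.sqrt_mul (sq_nonneg _), Complex.norm_eq_sqrt_sq_add_sq]
  apply Real.sqrt_le_sqrt
  set m := σ * τ * (a * τ - b * σ) with hm
  have hre : (trialVertex P ⟨a, b⟩ σ τ - (conj (⟨a, b⟩ : ℂ) ^ 2 * (s + P * s ^ 2 + P ^ 2 * s ^ 3 / 3)
        - (⟨a, b⟩ : ℂ) ^ 2 * (s ^ 3 / 3 + P * s ^ 2 + P ^ 2 * s))).re =
      (1 - P ^ 2) * ((a * σ + b * τ) * (π / 4) - (s - s ^ 3 / 3) * (a ^ 2 - b ^ 2)) := by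
    simp [trialVertex, pow_succ, -map_mul]
    ring
  have him : (trialVertex P ⟨a, b⟩ σ τ - (conj (⟨a, b⟩ : ℂ) ^ 2 * (s + P * s ^ 2 + P ^ 2 * s ^ 3 / 3)
        - (⟨a, b⟩ : ℂ) ^ 2 * (s ^ 3 / 3 + P * s ^ 2 + P ^ 2 * s))).im =
      (1 + P ^ 2) * ((a * τ - b * σ) * (π / 4) + T * (π / 4) * (σ * τ)
        + 2 * a * b * (s + s ^ 3 / 3 + T * s ^ 2)) := by
    simp [trialVertex, pow_succ, -map_mul]
    linear_combination (π / 4 * σ * τ + 2 * a * b * s ^ 2) * hT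
  have hm2 : m ^ 2 = (a * τ - b * σ) ^ 2 := by rw [hm, mul_pow, hστ, one_mul]
  have hX : (a * σ + b * τ) ^ 2 = 2 - m ^ 2 := by
    rw [hm2]
    linear_combination (a ^ 2 + b ^ 2) * hτ + (a ^ 2 + b ^ 2) * hσ + 2 * hab
  have hw : a ^ 2 - b ^ 2 = (a * σ + b * τ) * m := by
    rw [hm]
    linear_combination (b ^ 2 - a ^ 2) * hστ - σ * τ * a * b * hτ + σ * τ * a * b * hσ
  have hz : 2 * a * b = σ * τ * (1 - m ^ 2) := by
    rw [hm2]
    linear_combination -2 * a * b * hστ + σ * τ * (hab + a ^ 2 * hτ + b ^ 2 * hσ)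
  have hZ : a * τ - b * σ = σ * τ * m := by
    rw [hm]; linear_combination -(a * τ - b * σ) * hστ
  clear_value m
  rw [hre, him, hw, hz, hZ, mul_pow (1 + P ^ 2)]
  have e1 : ((1 - P ^ 2) * ((a * σ + b * τ) * (π / 4) - (s - s ^ 3 / 3) * ((a * σ + b * τ) * m))) ^ 2
      = (1 - P ^ 2) ^ 2 * ((2 - m ^ 2) * (π / 4 - m * (s - s ^ 3 / 3)) ^ 2) := by
    rw [← hX]; ring
  have e2 : (σ * τ * m * (π / 4) + T * (π / 4) * (σ * τ)
      + σ * τ * (1 - m ^ 2) * (s + s ^ 3 / 3 + T * s ^ 2)) ^ 2 =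
      (π / 4 * m + T * (π / 4) + (1 - m ^ 2) * (s + s ^ 3 / 3 + T * s ^ 2)) ^ 2 := by
    linear_combination (π / 4 * m + T * (π / 4)
      + (1 - m ^ 2) * (s + s ^ 3 / 3 + T * s ^ 2)) ^ 2 * hστ
  rw [e1, e2, mul_add ((1 + P ^ 2) ^ 2)]
  have h1 : (1 - P ^ 2) ^ 2 ≤ (1 + P ^ 2) ^ 2 := by linear_combination 4 * sq_nonneg P
  have h2 : 0 ≤ 2 - m ^ 2 := (sq_nonneg _).trans_eq hX
  exact add_le_add_left (mul_le_mul_of_nonneg_right h1 (mul_nonneg h2 (sq_nonneg _))) _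

/-- The trial map, before normalisation, has image in a disk about its value at `ε̄ s`. -/
lemma norm_harmonicCombination_quarticPrim_sub_le {P T s : ℝ} (hP : 0 ≤ P)
    (hPT : 2 * P = T * (1 + P ^ 2)) (hT0 : 0 ≤ T) (hT : T ≤ 1)
    (hs : s = min (3 / 4 * T) (3 / 10)) {ε : ℂ} (hε : ‖ε‖ = 1) {x : ℂ} (hx : ‖x‖ < 1) :
    ‖harmonicCombination P ε (quarticPrim₀ x) (quarticPrim₁ x) (quarticPrim₂ x)
      - harmonicCombination P ε (quarticPrim₀ (conj ε * s)) (quarticPrim₁ (conj ε * s))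
        (quarticPrim₂ (conj ε * s))‖ ≤
      (1 + P ^ 2) * (1.175 * ((1 - s ^ 2) * (1 + s ^ 2 + 2 * T * s) / (1 + s ^ 4))) := by
  have hs0 : 0 ≤ s := hs ▸ le_min (by linarith) (by norm_num)
  have hs1 : s ≤ 3 / 10 := hs ▸ min_le_right _ _
  have hn : ‖conj ε * (s : ℂ)‖ = s := by simp [hε, abs_of_nonneg hs0]
  have hy : ‖conj ε * (s : ℂ)‖ < 1 := by rw [hn]; linarith
  have hd : 0 < 1 - s ^ 4 := sub_pos.2 (pow_lt_one₀ hs0 (by linarith) four_ne_zero)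
  refine norm_harmonicCombination_sub_le (fun σ τ hσ hτ => ?_) hx
  obtain ⟨m, hm, hV⟩ := norm_trialVertex_sub_le (s := s) hPT hε hσ hτ
  have k0 := norm_sub_le_of_hasDerivAt_div (K := quarticPrim₀) (j := 0) (by simp [quarticPrim₀])
    (fun x hx => by simpa using (hasDerivAt_quarticPrim hx).1) hy
  have k1 := norm_sub_le_of_hasDerivAt_div (K := quarticPrim₁) (j := 1) (by simp [quarticPrim₁])
    (fun x hx => by simpa using (hasDerivAt_quarticPrim hx).2.1) hy
  have k2 := norm_sub_le_of_hasDerivAt_div (K := quarticPrim₂) (j := 2) (by simp [quarticPrim₂])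
    (fun x hx => (hasDerivAt_quarticPrim hx).2.2) hy
  rw [hn] at k0 k1 k2
  norm_num at k0 k1 k2
  have hC := norm_harmonicCombination_le hP hPT hε (conj ε * s - quarticPrim₀ (conj ε * s))
    ((conj ε * s) ^ 2 / 2 - quarticPrim₁ (conj ε * s))
    ((conj ε * s) ^ 3 / 3 - quarticPrim₂ (conj ε * s))
  rw [← harmonicCombination_sub, norm_sub_rev _ (quarticPrim₀ _), norm_sub_rev _ (quarticPrim₁ _),
    norm_sub_rev _ (quarticPrim₂ _)] at hC
  refine (norm_sub_le_norm_sub_add_norm_sub _ _ _).trans ((add_le_add hV hC).trans ?_)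
  rw [← mul_add]
  refine mul_le_mul_of_nonneg_left ?_ (by positivity)
  refine le_trans ?_ (vertex_distance_le_radius hT0 hT hs hm)
  rw [add_div, add_div, mul_div_assoc]
  gcongr

lemma exists_trial_parameter {p : ℝ} (hp0 : 0 ≤ p) (hp1 : p < 1) :
    ∃ P T s : ℝ, 0 ≤ P ∧ P < 1 ∧ 0 ≤ T ∧ T ≤ 1 ∧ 2 * P = T * (1 + P ^ 2) ∧
      s = min (3 / 4 * T) (3 / 10) ∧ p * (1 + P * s) = s + P := by
  set τ : ℝ → ℝ := fun P => 2 * P / (1 + P ^ 2) with hτ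
  set σ : ℝ → ℝ := fun P => min (3 / 4 * τ P) (3 / 10) with hσ
  have hτ0 : ∀ P ∈ Icc (0 : ℝ) 1, 0 ≤ τ P := fun P hP => div_nonneg (by linarith [hP.1]) (by positivity)
  have hσ0 : ∀ P ∈ Icc (0 : ℝ) 1, 0 ≤ σ P := fun P hP =>
    le_min (by linarith [hτ0 P hP]) (by norm_num)
  have hτc : Continuous τ := by
    refine (by fun_prop : Continuous fun P : ℝ => 2 * P).div (by fun_prop) fun P => ?_
    positivity
  have hσc : Continuous σ := by fun_prop
  have hpos : ∀ P ∈ Icc (0 : ℝ) 1, 0 < 1 + P * σ P := fun P hP => by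
    have := mul_nonneg hP.1 (hσ0 P hP); linarith
  obtain ⟨P, hP, h⟩ := intermediate_value_Icc (f := fun P => (σ P + P) / (1 + P * σ P)) zero_le_one
    ((by fun_prop : Continuous fun P => σ P + P).continuousOn.div
      (by fun_prop : Continuous fun P => 1 + P * σ P).continuousOn
      fun P hP => (hpos P hP).ne')
    (show p ∈ Icc _ _ from ⟨by simpa [hσ, hτ] using Or.inl hp0, by
      rw [one_mul, add_comm (σ 1), div_self (by simpa using (hpos 1 (by simp)).ne')]
      exact hp1.le⟩)
  have h' : p * (1 + P * σ P) = σ P + P := ((div_eq_iff (hpos P hP).ne').1 h).symm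
  refine ⟨P, τ P, σ P, hP.1, hP.2.lt_of_ne ?_, hτ0 P hP, ?_, ?_, rfl, h'⟩
  · rintro rfl
    nlinarith [hσ0 1 hP]
  · exact (div_le_one (by positivity)).2 (by nlinarith [sq_nonneg (P - 1)])
  · rw [hτ]; field_simp

lemma exists_unit_direction {q : ℝ} (hq0 : 0 ≤ q) (hq : q < 1) {η : ℂ} (hη : ‖η‖ = 1) :
    ∃ ε : ℂ, ‖ε‖ = 1 ∧ conj ε ^ 2 * ‖1 - (conj ε ^ 2) ^ 2 * q‖ = η * (1 - (conj ε ^ 2) ^ 2 * q) := by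
  set v : ℂ := ⟨η.re / (1 - q), η.im / (1 + q)⟩ with hv
  have hvη : v - q * conj v = η := by
    have h1 : 1 - q ≠ 0 := by linarith
    have h2 : 1 + q ≠ 0 := by linarith
    apply Complex.ext <;> simp [hv] <;> field_simp
  have hv0 : v ≠ 0 := by
    intro h
    rw [h] at hvη
    simp [← hvη] at hη
  have hvn : 0 < ‖v‖ := norm_pos_iff.2 hv0
  set w := v / ‖v‖ with hw
  have hwn : ‖w‖ = 1 := by rw [hw, norm_div]; simp [hvn.ne']
  have hww : w * conj w = 1 := by rw [Complex.mul_conj, Complex.normSq_eq_norm_sq, hwn]; simp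
  obtain ⟨e, he⟩ := IsAlgClosed.exists_pow_nat_eq w two_pos
  refine ⟨conj e, ?_, ?_⟩
  · rw [RCLike.norm_conj, ← sq_eq_sq₀ (norm_nonneg _) zero_le_one, ← norm_pow, he, hwn, one_pow]
  rw [Complex.conj_conj, he]
  have h1 : (‖v‖ : ℂ) * (w * (1 - q * conj w ^ 2)) = η := by
    have : conj w = conj v / ‖v‖ := by simp [hw]
    have hc : (‖v‖ : ℂ) ≠ 0 := by exact_mod_cast hvn.ne'
    have : (‖v‖ : ℂ) * (w - q * conj w) = η := by
      rw [this, hw, ← hvη]; field_simp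
    linear_combination this - ‖v‖ * q * conj w * hww
  have hconj : conj (1 - w ^ 2 * q) = 1 - q * conj w ^ 2 := by simp [mul_comm]
  rw [← hconj] at h1
  have h2 : ‖v‖ * ‖1 - w ^ 2 * q‖ = 1 := by
    have := congrArg norm h1
    rwa [norm_mul, norm_mul, RCLike.norm_conj, hwn, hη, one_mul, Complex.norm_real, norm_norm]
      at this
  have h3 : (‖v‖ : ℂ) * ‖1 - w ^ 2 * q‖ = 1 := by exact_mod_cast h2
  have h4 : (1 - w ^ 2 * q) * conj (1 - w ^ 2 * q) = (‖1 - w ^ 2 * q‖ : ℂ) ^ 2 :=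
    Complex.mul_conj' _
  rw [← h1]
  linear_combination -w * ‖1 - w ^ 2 * q‖ * h3 - ‖v‖ * w * h4

lemma hasDerivAt_disk_automorphism {P : ℝ} {ε z : ℂ} (hz : 1 - P * z ≠ 0) :
    HasDerivAt (fun z => ε * ((z - P) / (1 - P * z))) (ε * ((1 - P ^ 2) / (1 - P * z) ^ 2)) z := by
  have h1 : HasDerivAt (fun z : ℂ => z - P) 1 z := (hasDerivAt_id z).sub_const _
  have h2 : HasDerivAt (fun z : ℂ => 1 - P * z) (-(P : ℂ)) z := by
    simpa using ((hasDerivAt_id z).const_mul (P : ℂ)).const_sub 1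
  refine ((h1.div h2 hz).const_mul ε).congr_deriv ?_
  congr 2; ring

lemma norm_disk_automorphism_lt {P : ℝ} (hP0 : 0 ≤ P) (hP : P < 1) {z : ℂ} (hz : ‖z‖ < 1) :
    1 - P * z ≠ 0 ∧ ‖(z - P) / (1 - P * z)‖ < 1 := by
  have h0 : 1 - P * z ≠ 0 := by
    intro h
    have : ‖(P : ℂ) * z‖ < 1 := by
      rw [norm_mul, Complex.norm_real, Real.norm_of_nonneg hP0]
      nlinarith [norm_nonneg z]
    rw [← sub_eq_zero.1 h, norm_one] at this
    exact lt_irrefl _ this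
  refine ⟨h0, ?_⟩
  rw [norm_div, div_lt_one (norm_pos_iff.2 h0), ← sq_lt_sq₀ (norm_nonneg _) (norm_nonneg _),
    Complex.sq_norm, Complex.sq_norm, Complex.normSq_apply, Complex.normSq_apply]
  have hz2 : z.re * z.re + z.im * z.im < 1 := by
    rw [← Complex.normSq_apply, ← Complex.sq_norm]
    exact pow_lt_one₀ (norm_nonneg _) hz two_ne_zero
  simp
  have : 0 < (1 - P ^ 2) * (1 - (z.re * z.re + z.im * z.im)) :=
    mul_pos (by nlinarith) (by linarith)
  linear_combination this

/-- Existence of trial maps with the dilatation `z ^ 2` and an almost optimal derivative. -/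
theorem exists_trial_map {p : ℝ} (hp0 : 0 ≤ p) (hp1 : p < 1) {η : ℂ} (hη : ‖η‖ = 1) :
    ∃ (h g : ℂ → ℂ) (t : ℝ), DifferentiableOn ℂ h (Metric.ball 0 1) ∧
      DifferentiableOn ℂ g (Metric.ball 0 1) ∧
      (∀ z ∈ Metric.ball (0 : ℂ) 1, deriv g z = z ^ 2 * deriv h z) ∧
      (∀ z ∈ Metric.ball (0 : ℂ) 1, ‖h z + conj (g z)‖ ≤ 1) ∧ h p + conj (g p) = 0 ∧
      deriv h p = t * η ∧ 1 ≤ 1.175 * (t * (1 - p ^ 4)) := by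
  obtain ⟨P, T, s, hP0, hP1, hT0, hT1, hPT, hs, hp⟩ := exists_trial_parameter hp0 hp1
  have hs0 : 0 ≤ s := hs ▸ le_min (by linarith) (by norm_num)
  have hs1 : s < 1 := hs ▸ (min_le_right _ _).trans_lt (by norm_num)
  have hs4 : s ^ 4 < 1 := pow_lt_one₀ hs0 hs1 four_ne_zero
  obtain ⟨ε, hε, hdir⟩ := exists_unit_direction (q := s ^ 4) (by positivity) hs4
    (η := -Complex.I * η) (by simp [hη])
  have hε2 : ε * conj ε = 1 := by rw [Complex.mul_conj, Complex.normSq_eq_norm_sq, hε]; simp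
  set R := (1 + P ^ 2) * (1.175 * ((1 - s ^ 2) * (1 + s ^ 2 + 2 * T * s) / (1 + s ^ 4))) with hR
  have hs2 : 0 < 1 - s ^ 2 := by nlinarith
  have hRpos : 0 < R := by positivity
  have hP2 : 0 < 1 - P ^ 2 := by nlinarith
  set D : ℂ := 1 - (conj ε ^ 2) ^ 2 * (s ^ 4 : ℝ) with hD
  have hD0 : 0 < ‖D‖ := by
    have := norm_sub_norm_le (1 : ℂ) ((conj ε ^ 2) ^ 2 * (s ^ 4 : ℝ))
    rw [norm_one, norm_mul, norm_pow, norm_pow, RCLike.norm_conj, hε, Complex.norm_real,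
      Real.norm_of_nonneg (by positivity)] at this
    linarith
  set φ : ℂ → ℂ := fun z => conj ε * ((z - P) / (1 - P * z)) with hφ
  have hφd : ∀ z : ℂ, ‖z‖ < 1 →
      HasDerivAt φ (conj ε * ((1 - P ^ 2) / (1 - P * z) ^ 2)) z := fun z hz =>
    hasDerivAt_disk_automorphism (norm_disk_automorphism_lt hP0 hP1 hz).1
  have hφ1 : ∀ z : ℂ, ‖z‖ < 1 → ‖φ z‖ < 1 := fun z hz => by
    simpa [hφ, hε] using (norm_disk_automorphism_lt hP0 hP1 hz).2
  have hPs : 0 < 1 + P * s := by positivity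
  have hpn : ‖(p : ℂ)‖ < 1 := by rwa [Complex.norm_real, Real.norm_of_nonneg hp0]
  have hpP : (1 - P * p) * (1 + P * s) = 1 - P ^ 2 := by linear_combination -P * hp
  have hφp : φ p = conj ε * s := by
    have h1 : (1 : ℂ) - P * p ≠ 0 := (norm_disk_automorphism_lt hP0 hP1 hpn).1
    have : p - P = s * (1 - P * p) := by linear_combination hp
    have : (p : ℂ) - P = s * (1 - P * p) := by exact_mod_cast this
    simp only [hφ]
    rw [this, mul_div_cancel_right₀ _ h1]
  set A : ℂ → ℂ := fun x => (R⁻¹ : ℝ) * Complex.I * (conj ε * quarticPrim₀ x + 2 * P * quarticPrim₁ x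
    + P ^ 2 * ε * quarticPrim₂ x) with hA
  set B : ℂ → ℂ := fun x => (R⁻¹ : ℝ) * Complex.I * (ε * quarticPrim₂ x + 2 * P * quarticPrim₁ x
    + P ^ 2 * conj ε * quarticPrim₀ x) with hB
  have hAd : ∀ z : ℂ, ‖z‖ < 1 → HasDerivAt (fun z => A (φ z) - A (φ p))
      ((R⁻¹ : ℝ) * Complex.I * (conj ε * (1 / (1 - φ z ^ 4)) + 2 * P * (φ z / (1 - φ z ^ 4))
        + P ^ 2 * ε * (φ z ^ 2 / (1 - φ z ^ 4))) * (conj ε * ((1 - P ^ 2) / (1 - P * z) ^ 2))) z := by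
    intro z hz
    obtain ⟨k0, k1, k2⟩ := hasDerivAt_quarticPrim (hφ1 z hz)
    exact (((((k0.const_mul _).add (k1.const_mul _)).add (k2.const_mul _)).const_mul _).comp z
      (hφd z hz)).sub_const _
  have hBd : ∀ z : ℂ, ‖z‖ < 1 → HasDerivAt (fun z => B (φ z) - B (φ p))
      ((R⁻¹ : ℝ) * Complex.I * (ε * (φ z ^ 2 / (1 - φ z ^ 4)) + 2 * P * (φ z / (1 - φ z ^ 4))
        + P ^ 2 * conj ε * (1 / (1 - φ z ^ 4))) * (conj ε * ((1 - P ^ 2) / (1 - P * z) ^ 2))) z := by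
    intro z hz
    obtain ⟨k0, k1, k2⟩ := hasDerivAt_quarticPrim (hφ1 z hz)
    exact (((((k2.const_mul _).add (k1.const_mul _)).add (k0.const_mul _)).const_mul _).comp z
      (hφd z hz)).sub_const _
  have hAB : ∀ x, A x + conj (B x) = (R⁻¹ : ℝ) * Complex.I *
      harmonicCombination P ε (quarticPrim₀ x) (quarticPrim₁ x) (quarticPrim₂ x) := fun x => by
    simp only [hA, hB, harmonicCombination, map_mul, Complex.conj_ofReal, Complex.conj_I]
    ring
  refine ⟨fun z => A (φ z) - A (φ p), fun z => B (φ z) - B (φ p),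
    R⁻¹ * ((1 + P * s) ^ 4 / ((1 - P ^ 2) * ‖D‖)),
    fun z hz => (hAd z (mem_ball_zero_iff.1 hz)).differentiableAt.differentiableWithinAt,
    fun z hz => (hBd z (mem_ball_zero_iff.1 hz)).differentiableAt.differentiableWithinAt,
    fun z hz => ?_, fun z hz => ?_, by simp, ?_, ?_⟩
  · have hz1 := mem_ball_zero_iff.1 hz
    rw [(hAd z hz1).deriv, (hBd z hz1).deriv]
    have hσ : ε * φ z * (1 - P * z) = z - P := by
      have := (norm_disk_automorphism_lt hP0 hP1 hz1).1
      rw [hφ, ← mul_assoc, hε2, one_mul, div_mul_cancel₀ _ this]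
    generalize φ z = x at *
    have key : ε * x ^ 2 + 2 * P * x + P ^ 2 * conj ε
        = z ^ 2 * (conj ε + 2 * P * x + P ^ 2 * ε * x ^ 2) := by
      have h1 : z * (1 + P * (ε * x)) = ε * x + P := by linear_combination -hσ
      have h2 : ε * x ^ 2 + 2 * P * x + P ^ 2 * conj ε = conj ε * (ε * x + P) ^ 2 := by
        linear_combination -(ε * x ^ 2 + 2 * P * x) * hε2
      have h3 : conj ε + 2 * P * x + P ^ 2 * ε * x ^ 2 = conj ε * (1 + P * (ε * x)) ^ 2 := by
        linear_combination -(2 * P * x + P ^ 2 * ε * x ^ 2) * hε2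
      rw [h2, h3, ← h1]; ring
    linear_combination ((R⁻¹ : ℝ) * Complex.I * (1 - x ^ 4)⁻¹ *
      (conj ε * ((1 - P ^ 2) / (1 - P * z) ^ 2))) * key
  · have e : A (φ z) - A (φ p) + conj (B (φ z) - B (φ p)) =
        (A (φ z) + conj (B (φ z))) - (A (φ p) + conj (B (φ p))) := by rw [map_sub]; ring
    simp only
    rw [e, hAB, hAB, ← mul_sub, norm_mul, norm_mul, Complex.norm_I, mul_one, Complex.norm_real,
      Real.norm_of_nonneg (inv_nonneg.2 hRpos.le), hφp, inv_mul_le_one₀ hRpos]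
    exact norm_harmonicCombination_quarticPrim_sub_le hP0 hPT hT0 hT1 hs hε
      (hφ1 z (mem_ball_zero_iff.1 hz))
  · rw [(hAd p hpn).deriv, hφp]
    have h1 : ((1 : ℂ) - P ^ 2) / (1 - P * p) ^ 2 = (1 + P * s) ^ 2 / (1 - P ^ 2) := by
      have e : ((1 : ℂ) - P * p) * (1 + P * s) = 1 - P ^ 2 := by exact_mod_cast hpP
      rw [div_eq_div_iff (pow_ne_zero 2 (norm_disk_automorphism_lt hP0 hP1 hpn).1)
        (by exact_mod_cast hP2.ne'), ← e]
      ring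
    have h2 : (conj ε * (s : ℂ)) ^ 4 = (conj ε ^ 2) ^ 2 * (s ^ 4 : ℝ) := by push_cast; ring
    rw [h1, h2]
    have hDc : (‖D‖ : ℂ) ≠ 0 := by exact_mod_cast hD0.ne'
    have hD1 : D ≠ 0 := norm_pos_iff.1 hD0
    have hP2c : (1 : ℂ) - P ^ 2 ≠ 0 := by exact_mod_cast hP2.ne'
    have hRc : (R : ℂ) ≠ 0 := by exact_mod_cast hRpos.ne'
    have h3 : conj ε * (1 / D) + 2 * P * (conj ε * s / D) + P ^ 2 * ε * ((conj ε * s) ^ 2 / D)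
        = conj ε * (1 + P * s) ^ 2 / D := by
      linear_combination (P ^ 2 * conj ε * s ^ 2 / D) * hε2
    have h4 : conj ε ^ 2 * Complex.I / D = η / ‖D‖ := by
      rw [div_eq_div_iff hD1 hDc]
      linear_combination Complex.I * hdir - η * D * Complex.I_sq
    rw [h3]
    push_cast
    rw [div_mul_eq_div_div ((1 + P * s : ℂ) ^ 4)]
    linear_combination ((R : ℂ)⁻¹ * (1 + P * s) ^ 4 / (1 - P ^ 2)) * h4
  · have h1 : (1 + P * s) ^ 4 * (1 - p ^ 4)
        = (1 - P ^ 2) * ((1 - s ^ 2) * ((1 + P ^ 2) * (1 + s ^ 2 + 2 * T * s))) := by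
      have e : (1 + P * s) ^ 4 * (1 - p ^ 4) = (1 + P * s) ^ 4 - (s + P) ^ 4 := by
        rw [← hp]; ring
      rw [e]
      linear_combination (2 * s * (1 - P ^ 2) * (1 - s ^ 2)) * hPT
    have h2 : 1.175 * (R⁻¹ * ((1 + P * s) ^ 4 / ((1 - P ^ 2) * ‖D‖)) * (1 - p ^ 4))
        = 1.175 * ((1 + P * s) ^ 4 * (1 - p ^ 4)) / (R * ((1 - P ^ 2) * ‖D‖)) := by
      rw [mul_div_assoc', ← div_eq_inv_mul]
      field_simp
    rw [h2, h1, one_le_div (by positivity)]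
    have h3 : R * (1 + s ^ 4) = 1.175 * ((1 - s ^ 2) * ((1 + P ^ 2) * (1 + s ^ 2 + 2 * T * s))) := by
      rw [hR]; field_simp
    have h4 : ‖D‖ ≤ 1 + s ^ 4 := by
      refine (norm_sub_le _ _).trans_eq ?_
      rw [norm_one, norm_mul, norm_pow, norm_pow, RCLike.norm_conj, hε, Complex.norm_real,
        Real.norm_of_nonneg (by positivity)]
      ring
    calc R * ((1 - P ^ 2) * ‖D‖) ≤ R * ((1 - P ^ 2) * (1 + s ^ 4)) := by gcongr
      _ = _ := by linear_combination (1 - P ^ 2) * h3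

/-- A harmonic diffeomorphism onto the disk normalised by `h' = 1 / 2` has a dilatation whose
derivative is not too large. -/
theorem norm_deriv_dilatation_le {Ω : Set ℂ} (hΩ : IsOpen Ω) (hc : IsPreconnected Ω)
    {h g q : ℂ → ℂ} (hh : DifferentiableOn ℂ h Ω) (hg : DifferentiableOn ℂ g Ω)
    (hq : DifferentiableOn ℂ q Ω) (hq1 : ∀ z ∈ Ω, ‖q z‖ < 1)
    (hh' : ∀ z ∈ Ω, deriv h z = 1 / 2) (hgh : ∀ z ∈ Ω, deriv g z = q z ^ 2 * deriv h z)
    (hinj : InjOn (fun z => h z + conj (g z)) Ω)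
    (himg : (fun z => h z + conj (g z)) '' Ω = Metric.ball 0 1)
    (hcpt : ∀ r < 1, IsCompact {z ∈ Ω | ‖h z + conj (g z)‖ ≤ r}) {z₀ : ℂ} (hz₀ : z₀ ∈ Ω)
    (h0 : h z₀ + conj (g z₀) = 0) :
    2 * ‖deriv q z₀‖ ≤ 1.175 * (1 - ‖q z₀‖ ^ 4) := by
  by_contra! hlt
  set p := ‖q z₀‖ with hp
  have hp1 : p < 1 := hq1 z₀ hz₀
  have hp4 : 0 < 1 - p ^ 4 := sub_pos.2 (pow_lt_one₀ (norm_nonneg _) hp1 four_ne_zero)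
  have hd0 : 0 < ‖deriv q z₀‖ := by linarith
  obtain ⟨u, hu, hpu⟩ : ∃ u : ℂ, ‖u‖ = 1 ∧ q z₀ = p * u :=
    ⟨Complex.exp ((q z₀).arg * Complex.I), Complex.norm_exp_ofReal_mul_I _,
      (Complex.norm_mul_exp_arg_mul_I _).symm⟩
  have huu : u * conj u = 1 := by rw [Complex.mul_conj, Complex.normSq_eq_norm_sq, hu]; simp
  set d := conj u ^ 2 * deriv q z₀ with hd
  have hdn : ‖d‖ = ‖deriv q z₀‖ := by simp [hd, hu]
  obtain ⟨H, G, t, hH, hG, hGH, hle, hz, ht, hbd⟩ := exists_trial_map (norm_nonneg (q z₀)) hp1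
    (η := conj d / ‖d‖) (by rw [norm_div, RCLike.norm_conj]; simp [hdn, hd0.ne'])
  have ht0 : 0 < t := by
    by_contra! h
    nlinarith
  have hlam : 1 < 2 * (t * ‖deriv q z₀‖) := by
    have := mul_lt_mul_of_pos_left hlt ht0
    linarith
  set lam : ℝ := (2 * (t * ‖deriv q z₀‖))⁻¹ with hlamd
  have hlam0 : 0 < lam := by positivity
  have hlam1 : lam < 1 := inv_lt_one_of_one_lt₀ hlam
  have hmem : ∀ z ∈ Ω, conj u * q z ∈ Metric.ball (0 : ℂ) 1 := fun z hz => by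
    simpa [hu] using hq1 z hz
  have hqd : ∀ z ∈ Ω, HasDerivAt (fun z => conj u * q z) (conj u * deriv q z) z := fun z hz =>
    (hq.differentiableAt (hΩ.mem_nhds hz)).hasDerivAt.const_mul _
  have hHd : ∀ z ∈ Ω, HasDerivAt (fun z => lam * conj u * H (conj u * q z))
      (lam * conj u * (deriv H (conj u * q z) * (conj u * deriv q z))) z := fun z hz =>
    ((hH.differentiableAt (Metric.isOpen_ball.mem_nhds (hmem z hz))).hasDerivAt.comp z
      (hqd z hz)).const_mul _
  have hGd : ∀ z ∈ Ω, HasDerivAt (fun z => lam * u * G (conj u * q z))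
      (lam * u * (deriv G (conj u * q z) * (conj u * deriv q z))) z := fun z hz =>
    ((hG.differentiableAt (Metric.isOpen_ball.mem_nhds (hmem z hz))).hasDerivAt.comp z
      (hqd z hz)).const_mul _
  have hsum : ∀ z, lam * conj u * H (conj u * q z) + conj (lam * u * G (conj u * q z)) =
      lam * conj u * (H (conj u * q z) + conj (G (conj u * q z))) := fun z => by
    simp only [map_mul, Complex.conj_ofReal]; ring
  have hp' : conj u * q z₀ = p := by rw [hpu]; linear_combination p * huu
  refine harmonic_comparison hΩ hc hh hg
    (H := fun z => lam * conj u * H (conj u * q z)) (G := fun z => lam * u * G (conj u * q z))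
    (fun z hz => (hHd z hz).differentiableAt.differentiableWithinAt)
    (fun z hz => (hGd z hz).differentiableAt.differentiableWithinAt) hq.continuousOn hq1 hgh
    (fun z hz => ?_) hinj himg hcpt hlam1 (fun z hz => ?_) hz₀ ?_ ?_
  · rw [(hHd z hz).deriv, (hGd z hz).deriv, hGH _ (hmem z hz)]
    linear_combination (lam * conj u ^ 2 * q z ^ 2 * deriv H (conj u * q z) * deriv q z) * huu
  · rw [hsum, norm_mul, norm_mul, RCLike.norm_conj, hu, mul_one, Complex.norm_real,
      Real.norm_of_nonneg hlam0.le]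
    exact mul_le_of_le_one_right hlam0.le (hle _ (hmem z hz))
  · rw [hsum, hp', hz, mul_zero, h0]
  · rw [(hHd z₀ hz₀).deriv, hp', ht, hh' z₀ hz₀]
    have h1 : conj d * d = (‖d‖ : ℂ) ^ 2 := Complex.conj_mul' d
    have h2 : (‖d‖ : ℂ) ≠ 0 := by rw [hdn]; exact_mod_cast hd0.ne'
    have h3 : (t : ℂ) ≠ 0 := by exact_mod_cast ht0.ne'
    have h4 : conj u * (conj u * deriv q z₀) = d := by rw [hd]; ring
    have h5 : lam * conj u * (t * (conj d / ‖d‖) * (conj u * deriv q z₀))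
        = lam * t * (conj d * d) / ‖d‖ := by rw [← h4]; ring
    rw [h5, h1, hlamd, ← hdn]
    push_cast
    field_simp

lemma hopf_constant_gt : (5.5225 : ℝ) < 2 * π ^ 2 / 27 * (2 + √31) := by
  have h1 : (5.567 : ℝ) < √31 := Real.lt_sqrt_of_sq_lt (by norm_num)
  have h2 : (9.869 : ℝ) < π ^ 2 := by nlinarith [pi_gt_d4]
  nlinarith

end

/-- For any minimal graph over the unit disk, at the origin the
scale-invariant curvature quantity `W² |K|` is less than `(2π²/27)(2+√31)`. -/
theorem hopf_constant_bound (f : ℝ × ℝ → ℝ) (hf : IsMinimalGraph f) :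
    |pu (pu f) ((0 : ℝ), (0 : ℝ)) * pv (pv f) ((0 : ℝ), (0 : ℝ))
        - (pv (pu f) ((0 : ℝ), (0 : ℝ))) ^ 2|
      / (1 + (pu f ((0 : ℝ), (0 : ℝ))) ^ 2 + (pv f ((0 : ℝ), (0 : ℝ))) ^ 2)
    < 2 * π ^ 2 / 27 * (2 + Real.sqrt 31) := by
  obtain ⟨Ω, h, g, q, z₀, hΩ, hc, hh, hg, hq, hq1, hh', hgh, hinj, himg, hcpt, hz₀, h0, hK⟩ :=
    hf.exists_harmonic_parametrisation
  refine lt_of_le_of_lt ?_ hopf_constant_gt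
  have hle := norm_deriv_dilatation_le hΩ hc hh hg hq hq1 hh' hgh hinj himg hcpt hz₀ h0
  have hp : 0 < 1 - ‖q z₀‖ ^ 4 :=
    sub_pos.2 (pow_lt_one₀ (norm_nonneg _) (hq1 z₀ hz₀) four_ne_zero)
  refine le_of_mul_le_mul_right ?_ (pow_pos hp 2)
  rw [← hK]
  nlinarith [norm_nonneg (deriv q z₀)]
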